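/- arXiv:0810.0743 — 7 statements merged into one kernel-verified Lean document; each statement's English description precedes it below -/
import Mathlib

section
/- Suppose R is a Gram–de Finetti matrix satisfying the Ghirlanda–Guerra identities and the finite-value condition. Then R is ultrametric: P(R_{2,3} ≥ min(R_{1,2}, R_{1,3})) = 1. -/
open MeasureTheory ProbabilityTheory

noncomputable section

/-- The space of infinite real matrices. -/
abbrev Mat := ℕ → ℕ → ℝ

/-- The strictly upper-triangular part of the top-left `n × n` submatrix. -/
def subU (n : ℕ) (M : Mat) : {p : Fin n × Fin n // p.1 < p.2} → ℝ :=
  fun p => M p.1.1 p.1.2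

/-- `R` is a Gram–de Finetti matrix under `P`: measurable, entries in `[-1,1]`,
symmetric, a.s. every finite submatrix positive semidefinite, and weakly
exchangeable. -/
def IsGramDeFinetti {Ω : Type*} [MeasurableSpace Ω] (P : Measure Ω) (R : Ω → Mat) : Prop :=
  Measurable R ∧
  (∀ᵐ ω ∂P, ∀ i j, R ω i j ∈ Set.Icc (-1 : ℝ) 1) ∧
  (∀ᵐ ω ∂P, ∀ i j, R ω i j = R ω j i) ∧
  (∀ᵐ ω ∂P, ∀ (n : ℕ) (c : Fin n → ℝ),
    0 ≤ ∑ i : Fin n, ∑ j : Fin n, c i * c j * R ω i j) ∧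
  (∀ (n : ℕ) (ρ : Equiv.Perm (Fin n)),
    Measure.map (fun ω => fun i j : Fin n => R ω (ρ i) (ρ j)) P
      = Measure.map (fun ω => fun i j : Fin n => R ω i j) P)

/-- `R` satisfies the Ghirlanda–Guerra identities under `P`. -/
def SatisfiesGGI {Ω : Type*} [MeasurableSpace Ω] (P : Measure Ω) (R : Ω → Mat) : Prop :=
  ∀ (n : ℕ), 2 ≤ n → ∀ (f : ({p : Fin n × Fin n // p.1 < p.2} → ℝ) → ℝ),
    Measurable f → (∃ C, ∀ x, |f x| ≤ C) →
    ∀ (ψ : ℝ → ℝ), Measurable ψ → (∃ C, ∀ x, |ψ x| ≤ C) →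
    ∫ ω, f (subU n (R ω)) * ψ (R ω 0 n) ∂P
      = (1 / n) * (∫ ω, f (subU n (R ω)) ∂P) * (∫ ω, ψ (R ω 0 1) ∂P)
        + (1 / n) * ∑ l ∈ Finset.Ico 1 n, ∫ ω, f (subU n (R ω)) * ψ (R ω 0 l) ∂P

/-- The finite-value condition: ones on the diagonal, and the off-diagonal entries
take values `q 1 < ⋯ < q k` with probabilities `m (l+1) - m l`, where
`0 ≤ q 1`, `q k ≤ 1`, `0 = m 1 < ⋯ < m k < m (k+1) = 1`. -/
def FiniteValueCondition {Ω : Type*} [MeasurableSpace Ω] (P : Measure Ω) (R : Ω → Mat)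
    (k : ℕ) (q m : ℕ → ℝ) : Prop :=
  (∀ᵐ ω ∂P, ∀ l, R ω l l = 1) ∧
  (∀ l, 1 ≤ l → l < k → q l < q (l + 1)) ∧ (0 ≤ q 1) ∧ (q k ≤ 1) ∧
  (m 1 = 0) ∧ (m (k + 1) = 1) ∧ (∀ l, 1 ≤ l → l ≤ k → m l < m (l + 1)) ∧
  (∀ l, 1 ≤ l → l ≤ k →
    P {ω | R ω 0 1 = q l} = ENNReal.ofReal (m (l + 1) - m l))

/-- Simultaneous permutation of the rows and columns of an infinite matrix. -/
def permute (ρ : Equiv.Perm ℕ) (M : Mat) : Mat := fun i j => M (ρ i) (ρ j)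

lemma measurable_entry (i j : ℕ) : Measurable fun M : Mat => M i j :=
  (measurable_pi_apply j).comp (measurable_pi_apply i)

lemma measurable_permute (ρ : Equiv.Perm ℕ) : Measurable (permute ρ) :=
  measurable_pi_iff.2 fun i => measurable_pi_iff.2 fun j => measurable_entry (ρ i) (ρ j)

/-- The top-left `n × n` block of an infinite matrix. -/
def corner (n : ℕ) (M : Mat) : Fin n → Fin n → ℝ := fun i j => M i j

lemma measurable_corner (n : ℕ) : Measurable (corner n) :=
  measurable_pi_iff.2 fun i => measurable_pi_iff.2 fun j => measurable_entry i j

/-- Finite measures on infinite matrices are determined by their finite corners. -/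
lemma ext_of_corner {μ ν : Measure Mat} [IsFiniteMeasure μ]
    (h : ∀ᶠ n in Filter.atTop, μ.map (corner n) = ν.map (corner n)) : μ = ν := by
  obtain ⟨N₀, h⟩ := Filter.eventually_atTop.1 h
  have key : ∀ n (T : Set (Fin n → Fin n → ℝ)), MeasurableSet T →
      μ (corner n ⁻¹' T) = ν (corner n ⁻¹' T) := by
    intro n T hT
    set k := max n N₀
    have hk : n ≤ k := le_max_left _ _
    let r : (Fin k → Fin k → ℝ) → (Fin n → Fin n → ℝ) :=
      fun A i j => A (Fin.castLE hk i) (Fin.castLE hk j)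
    have hr : Measurable r := measurable_pi_iff.2 fun i => measurable_pi_iff.2 fun j =>
      (measurable_pi_apply (Fin.castLE hk j)).comp (measurable_pi_apply (Fin.castLE hk i))
    have e : corner n ⁻¹' T = corner k ⁻¹' (r ⁻¹' T) := rfl
    rw [e, ← Measure.map_apply (measurable_corner k) (hr hT),
      ← Measure.map_apply (measurable_corner k) (hr hT), h k (le_max_right _ _)]
  refine ext_of_generate_finite
    {S | ∃ n, ∃ T : Set (Fin n → Fin n → ℝ), MeasurableSet T ∧ corner n ⁻¹' T = S} ?_ ?_ ?_ ?_
  · refine le_antisymm ?_ ?_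
    · refine iSup_le fun i => ?_
      rw [MeasurableSpace.pi, MeasurableSpace.comap_iSup]
      refine iSup_le fun j => ?_
      rw [MeasurableSpace.comap_comp]
      rintro S ⟨T, hT, rfl⟩
      refine MeasurableSpace.measurableSet_generateFrom ⟨max i j + 1,
        (fun A => A ⟨i, by omega⟩ ⟨j, by omega⟩) ⁻¹' T, ?_, rfl⟩
      exact ((measurable_pi_apply _).comp (measurable_pi_apply _)) hT
    · refine MeasurableSpace.generateFrom_le ?_
      rintro S ⟨n, T, hT, rfl⟩
      exact measurable_corner n hT
  · rintro S ⟨n, T, hT, rfl⟩ S' ⟨n', T', hT', rfl⟩ -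
    have hk : n ≤ max n n' := le_max_left _ _
    have hk' : n' ≤ max n n' := le_max_right _ _
    refine ⟨max n n', (fun A i j => A (Fin.castLE hk i) (Fin.castLE hk j)) ⁻¹' T ∩
      (fun A i j => A (Fin.castLE hk' i) (Fin.castLE hk' j)) ⁻¹' T', ?_, rfl⟩
    refine MeasurableSet.inter (measurableSet_preimage ?_ hT)
      (measurableSet_preimage ?_ hT') <;>
    exact measurable_pi_iff.2 fun i => measurable_pi_iff.2 fun j =>
      (measurable_pi_apply _).comp (measurable_pi_apply _)
  · rintro S ⟨n, T, hT, rfl⟩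
    exact key n T hT
  · simpa using key 0 Set.univ MeasurableSet.univ

section Overlaps

variable {Ω : Type*} [MeasurableSpace Ω] {P : Measure Ω} {R : Ω → Mat}

lemma map_permute_swap [IsProbabilityMeasure P] (h : IsGramDeFinetti P R) (i j : ℕ) :
    (P.map R).map (permute (Equiv.swap i j)) = P.map R := by
  obtain ⟨hm, -, -, -, hex⟩ := h
  have := Measure.isProbabilityMeasure_map (μ := P) hm.aemeasurable
  refine (ext_of_corner ?_).symm
  filter_upwards [Filter.eventually_gt_atTop i, Filter.eventually_gt_atTop j] with n hi hj
  rw [Measure.map_map (measurable_corner n) hm,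
    Measure.map_map (measurable_corner n) (measurable_permute _),
    Measure.map_map ((measurable_corner n).comp (measurable_permute _)) hm]
  refine (hex n (Equiv.swap ⟨i, hi⟩ ⟨j, hj⟩)).symm.trans ?_
  congr 1
  have e : ∀ a : Fin n, ((Equiv.swap ⟨i, hi⟩ ⟨j, hj⟩ a : Fin n) : ℕ) = Equiv.swap i j a := by
    intro a
    simp only [Equiv.swap_apply_def, Fin.ext_iff]
    split_ifs <;> rfl
  funext ω a b
  simp only [e, corner, permute, Function.comp]

/-- `S` depends only on the entries of the top-left `n × n` block. -/
def OnCorner (n : ℕ) (S : Set Mat) : Prop :=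
  ∀ M M' : Mat, (∀ i < n, ∀ j < n, M i j = M' i j) → M ∈ S → M' ∈ S

/-- The symmetric matrix with unit diagonal and given strictly upper-triangular part
(zero outside the top-left block). -/
def ofUpper (n : ℕ) (x : {p : Fin n × Fin n // p.1 < p.2} → ℝ) : Mat := fun i j =>
  if h : i < j ∧ j < n then x ⟨(⟨i, h.1.trans h.2⟩, ⟨j, h.2⟩), h.1⟩
  else if h : j < i ∧ i < n then x ⟨(⟨j, h.1.trans h.2⟩, ⟨i, h.2⟩), h.1⟩
  else if i = j then 1 else 0

lemma measurable_ofUpper (n : ℕ) : Measurable (ofUpper n) := by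
  refine measurable_pi_iff.2 fun i => measurable_pi_iff.2 fun j => ?_
  unfold ofUpper
  split_ifs <;> fun_prop

lemma ofUpper_subU {n : ℕ} {M : Mat} (hs : ∀ i j, M i j = M j i) (hd : ∀ i, M i i = 1)
    {i j : ℕ} (hi : i < n) (hj : j < n) : ofUpper n (subU n M) i j = M i j := by
  unfold ofUpper subU
  rcases lt_trichotomy i j with h | rfl | h
  · simp [h, hj]
  · simp [hd]
  · simp [h, h.not_gt, hi, hs i j]

lemma ggi_zero_lower_bound (h : IsGramDeFinetti P R) (hG : SatisfiesGGI P R)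
    (hd : ∀ᵐ ω ∂P, ∀ l, R ω l l = 1) {n : ℕ} (hn : 2 ≤ n) (a : ℝ) {S : Set Mat}
    (hS : MeasurableSet S) (hSn : OnCorner n S) (hSa : ∀ M ∈ S, ∀ l < n, l ≠ 0 → M 0 l ≤ a) :
    ((n - 1 : ℝ) / n) * (P.map R).real S ≤ (P.map R).real (S ∩ {M | M 0 n ≤ a}) := by
  obtain ⟨hm, -, hs, -, -⟩ := h
  have hT : MeasurableSet {M : Mat | M 0 n ≤ a} := measurable_entry 0 n measurableSet_Iic
  have hf : Measurable ((ofUpper n ⁻¹' S).indicator (fun _ => (1 : ℝ))) :=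
    measurable_const.indicator (measurable_ofUpper n hS)
  have hψ : Measurable ((Set.Iic a).indicator (fun _ => (1 : ℝ))) :=
    measurable_const.indicator measurableSet_Iic
  have bd : ∀ {α : Type} (s : Set α), ∃ C, ∀ x, |s.indicator (fun _ => (1 : ℝ)) x| ≤ C :=
    fun s => ⟨1, fun x => by by_cases hx : x ∈ s <;> simp [hx]⟩
  have key := hG n hn _ hf (bd _) _ hψ (bd _)
  have hmem : ∀ᵐ ω ∂P, (ofUpper n (subU n (R ω)) ∈ S ↔ R ω ∈ S) := by
    filter_upwards [hs, hd] with ω h1 h2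
    exact ⟨hSn _ _ fun i hi j hj => ofUpper_subU h1 h2 hi hj,
      hSn _ _ fun i hi j hj => (ofUpper_subU h1 h2 hi hj).symm⟩
  have i1 : ∫ ω, (ofUpper n ⁻¹' S).indicator (fun _ => (1 : ℝ)) (subU n (R ω)) *
      (Set.Iic a).indicator (fun _ => (1 : ℝ)) (R ω 0 n) ∂P
      = (P.map R).real (S ∩ {M | M 0 n ≤ a}) := by
    rw [map_measureReal_apply hm (hS.inter hT), ← integral_indicator_one (hm (hS.inter hT))]
    refine integral_congr_ae ?_
    filter_upwards [hmem] with ω h1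
    by_cases h2 : R ω ∈ S <;> by_cases h3 : R ω 0 n ≤ a <;> simp [Set.indicator, h1, h2, h3]
  have i2 : ∫ ω, (ofUpper n ⁻¹' S).indicator (fun _ => (1 : ℝ)) (subU n (R ω)) ∂P
      = (P.map R).real S := by
    rw [map_measureReal_apply hm hS, ← integral_indicator_one (hm hS)]
    refine integral_congr_ae ?_
    filter_upwards [hmem] with ω h1
    by_cases h2 : R ω ∈ S <;> simp [Set.indicator, h1, h2]
  have i3 : ∀ l ∈ Finset.Ico 1 n,
      ∫ ω, (ofUpper n ⁻¹' S).indicator (fun _ => (1 : ℝ)) (subU n (R ω)) *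
      (Set.Iic a).indicator (fun _ => (1 : ℝ)) (R ω 0 l) ∂P = (P.map R).real S := by
    intro l hl
    rw [Finset.mem_Ico] at hl
    rw [← i2]
    refine integral_congr_ae ?_
    filter_upwards [hmem] with ω h1
    by_cases h2 : R ω ∈ S
    · simp [Set.indicator, h1, h2, hSa _ h2 l hl.2 (by omega)]
    · simp [Set.indicator, h1, h2]
  have i4 : 0 ≤ ∫ ω, (Set.Iic a).indicator (fun _ => (1 : ℝ)) (R ω 0 1) ∂P :=
    integral_nonneg fun ω => Set.indicator_nonneg (fun _ _ => zero_le_one) _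
  rw [i1, i2, Finset.sum_congr rfl i3] at key
  rw [key, Finset.sum_const, Nat.card_Ico, nsmul_eq_mul, Nat.cast_sub (by omega)]
  have : 0 ≤ 1 / (n : ℝ) * (P.map R).real S *
      ∫ ω, (Set.Iic a).indicator (fun _ => (1 : ℝ)) (R ω 0 1) ∂P := by positivity
  have e : ((n - 1 : ℝ) / n) * (P.map R).real S
    = 1 / n * ((n - (1 : ℕ) : ℝ) * (P.map R).real S) := by push_cast; ring
  linarith

lemma map_real_preimage_swap [IsProbabilityMeasure P]
    (h : IsGramDeFinetti P R) (i j : ℕ) {S : Set Mat}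
    (hS : MeasurableSet S) :
    (P.map R).real (permute (Equiv.swap i j) ⁻¹' S) = (P.map R).real S := by
  conv_rhs => rw [← map_permute_swap h i j]
  rw [map_measureReal_apply (measurable_permute _) hS]

lemma ggi_lower_bound [IsProbabilityMeasure P] (h : IsGramDeFinetti P R) (hG : SatisfiesGGI P R)
    (hd : ∀ᵐ ω ∂P, ∀ l, R ω l l = 1) {n i : ℕ} (hn : 2 ≤ n) (hi : i < n) (a : ℝ) {S : Set Mat}
    (hS : MeasurableSet S) (hSn : OnCorner n S) (hSa : ∀ M ∈ S, ∀ l < n, l ≠ i → M i l ≤ a) :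
    ((n - 1 : ℝ) / n) * (P.map R).real S ≤ (P.map R).real (S ∩ {M | M i n ≤ a}) := by
  have hlt : ∀ l < n, Equiv.swap 0 i l < n := by
    intro l hl
    rw [Equiv.swap_apply_def]
    split_ifs <;> omega
  have hT : MeasurableSet {M : Mat | M i n ≤ a} := measurable_entry i n measurableSet_Iic
  have key := ggi_zero_lower_bound h hG hd hn a (measurable_permute (Equiv.swap 0 i) hS)
    (fun M M' hM => hSn _ _ fun a ha b hb => hM _ (hlt a ha) _ (hlt b hb))
    (fun M hM l hl hl0 => by
      have := hSa _ hM (Equiv.swap 0 i l) (hlt l hl)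
        (fun e => hl0 ((Equiv.swap 0 i).injective (e.trans (Equiv.swap_apply_left 0 i).symm)))
      simpa [permute] using this)
  rw [map_real_preimage_swap h 0 i hS] at key
  rw [← map_real_preimage_swap h 0 i (hS.inter hT)]
  convert key using 3
  ext M
  have : Equiv.swap 0 i n = n := Equiv.swap_apply_of_ne_of_ne (by omega) (by omega)
  simp [permute, this]

/-- The replicas `l < n` other than `i` satisfy the constraints `I`. -/
def baseEvent (n i : ℕ) (I : ℕ → ℕ → Set ℝ) : Set Mat :=
  {M | ∀ l < n, ∀ l' < n, l ≠ i → l' ≠ i → l ≠ l' → M l l' ∈ I l l'}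

/-- Replica `j` satisfies the constraints that `I` imposes on replica `i`
relative to the other replicas `l < n`. -/
def fitsEvent (n i : ℕ) (I : ℕ → ℕ → Set ℝ) (j : ℕ) : Set Mat :=
  {M | ∀ l < n, l ≠ i → M l j ∈ I l i ∧ M j l ∈ I i l}

lemma measurableSet_entry (i j : ℕ) {s : Set ℝ} (hs : MeasurableSet s) :
    MeasurableSet {M : Mat | M i j ∈ s} := measurable_entry i j hs

lemma measurableSet_baseEvent (n i : ℕ) {I : ℕ → ℕ → Set ℝ} (hI : ∀ l l', MeasurableSet (I l l')) :
    MeasurableSet (baseEvent n i I) := by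
  simp only [baseEvent, Set.ofPred_forall]
  exact .iInter fun l => .iInter fun _ => .iInter fun l' => .iInter fun _ => .iInter fun _ =>
    .iInter fun _ => .iInter fun _ => measurableSet_entry l l' (hI l l')

lemma measurableSet_fitsEvent (n i : ℕ) {I : ℕ → ℕ → Set ℝ}
    (hI : ∀ l l', MeasurableSet (I l l')) (j : ℕ) :
    MeasurableSet (fitsEvent n i I j) := by
  simp only [fitsEvent, Set.ofPred_forall]
  exact .iInter fun l => .iInter fun _ => .iInter fun _ =>
    (measurableSet_entry l j (hI l i)).inter (measurableSet_entry j l (hI i l))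

lemma permute_mem_baseEvent {n i : ℕ} {I : ℕ → ℕ → Set ℝ} {ρ : Equiv.Perm ℕ}
    (hρ : ∀ l < n, l ≠ i → ρ l = l) (M : Mat) :
    permute ρ M ∈ baseEvent n i I ↔ M ∈ baseEvent n i I := by
  simp only [baseEvent, Set.mem_ofPred_eq, permute]
  refine forall₂_congr fun l hl => forall₂_congr fun l' hl' => forall₂_congr fun h h' => ?_
  rw [hρ l hl h, hρ l' hl' h']

lemma permute_mem_fitsEvent {n i : ℕ} {I : ℕ → ℕ → Set ℝ} {ρ : Equiv.Perm ℕ}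
    (hρ : ∀ l < n, l ≠ i → ρ l = l) (j : ℕ) (M : Mat) :
    permute ρ M ∈ fitsEvent n i I j ↔ M ∈ fitsEvent n i I (ρ j) := by
  simp only [fitsEvent, Set.mem_ofPred_eq, permute]
  refine forall₂_congr fun l hl => forall_congr' fun h => ?_
  rw [hρ l hl h]

lemma not_summable_div_add (c : ℝ) (hc : 0 < c) (n : ℕ) :
    ¬ Summable fun k : ℕ => c / ((k + n : ℕ) : ℝ) := by
  intro h
  refine Real.not_summable_one_div_natCast ((summable_nat_add_iff n).1 ?_)
  simpa [div_eq_mul_inv, hc.ne'] using h.mul_left c⁻¹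

/-- Duplication property: a replica can be cloned so that the overlap of the clone with the
original is at most any common upper bound of the other overlaps of the original. -/
lemma duplication [IsProbabilityMeasure P] (h : IsGramDeFinetti P R) (hG : SatisfiesGGI P R)
    (hd : ∀ᵐ ω ∂P, ∀ l, R ω l l = 1) {n i : ℕ} (hn : 2 ≤ n) (hi : i < n) (a : ℝ)
    {I : ℕ → ℕ → Set ℝ} (hI : ∀ l l', MeasurableSet (I l l'))
    (hIa : ∀ l < n, l ≠ i → I i l ⊆ Set.Iic a)
    (hpos : 0 < (P.map R).real (baseEvent n i I ∩ fitsEvent n i I i)) :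
    0 < (P.map R).real (baseEvent n i I ∩ fitsEvent n i I i ∩ fitsEvent n i I n ∩
      {M | M i n ≤ a}) := by
  have := Measure.isProbabilityMeasure_map (μ := P) h.1.aemeasurable
  set μ := P.map R with hμ
  by_contra hzero
  replace hzero := le_antisymm (not_lt.1 hzero) measureReal_nonneg
  have hB := measurableSet_baseEvent n i hI
  have hF := measurableSet_fitsEvent n i hI
  have hLe : ∀ j, MeasurableSet {M : Mat | M i j ≤ a} := fun j =>
    measurableSet_entry i j measurableSet_Iic
  have hzero' : ∀ k, n ≤ k → ∀ᵐ M ∂μ, M ∈ baseEvent n i I → M ∈ fitsEvent n i I i →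
      M ∈ fitsEvent n i I k → ¬ M i k ≤ a := by
    intro k hk
    rw [← map_real_preimage_swap h n k (((hB.inter (hF i)).inter (hF n)).inter (hLe n)),
      measureReal_eq_zero_iff] at hzero
    filter_upwards [measure_eq_zero_iff_ae_notMem.1 hzero] with M hM h1 h2 h3 h4
    have hρ : ∀ l < n, l ≠ i → Equiv.swap n k l = l := fun l hl _ =>
      Equiv.swap_apply_of_ne_of_ne (by omega) (by omega)
    have hρi : Equiv.swap n k i = i := Equiv.swap_apply_of_ne_of_ne (by omega) (by omega)
    refine hM ⟨⟨⟨(permute_mem_baseEvent hρ M).2 h1, (permute_mem_fitsEvent hρ i M).2 ?_⟩,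
      (permute_mem_fitsEvent hρ n M).2 ?_⟩, ?_⟩
    · rwa [hρi]
    · rwa [Equiv.swap_apply_left]
    · simpa [permute, hρi] using h4
  let G : ℕ → Set Mat := fun m =>
    baseEvent n i I ∩ fitsEvent n i I i ∩ ⋂ j ∈ Finset.range m, {M | M i (n + j) ≤ a}
  have hGm : ∀ m, MeasurableSet (G m) := fun m => (hB.inter (hF i)).inter
    (Finset.measurableSet_biInter _ fun j _ => hLe _)
  have hGsucc : ∀ m, G (m + 1) = G m ∩ {M | M i (n + m) ≤ a} := by
    intro m
    ext M
    simp only [G, Set.mem_inter_iff, Set.mem_iInter, Finset.mem_range, Set.mem_ofPred_eq,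
      Nat.lt_succ_iff_lt_or_eq, or_imp, forall_and, forall_eq, and_assoc]
  have hlow : ∀ m, (n - 1) * μ.real (G 0) / ((m + (n - 1) : ℕ) : ℝ) ≤ μ.real (G m) := by
    have hn' : (2 : ℝ) ≤ n := by exact_mod_cast hn
    intro m
    rw [Nat.cast_add, Nat.cast_sub (by omega), Nat.cast_one]
    induction m with
    | zero =>
      rw [Nat.cast_zero, zero_add, mul_div_cancel_left₀ _ (by linarith)]
    | succ m ih =>
      have hm0 : (0 : ℝ) ≤ m := m.cast_nonneg
      have step := ggi_lower_bound h hG hd (n := n + m) (i := i) (by omega) (by omega) a (hGm m)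
        (by
          rintro M M' hM ⟨⟨h1, h2⟩, h3⟩
          refine ⟨⟨fun l hl l' hl' hli hli' hll => ?_, fun l hl hli => ?_⟩, ?_⟩
          · rw [← hM l (by omega) l' (by omega)]
            exact h1 l hl l' hl' hli hli' hll
          · rw [← hM l (by omega) i (by omega), ← hM i (by omega) l (by omega)]
            exact h2 l hl hli
          · simp only [Set.mem_iInter, Finset.mem_range, Set.mem_ofPred_eq] at h3 ⊢
            intro j hj
            rw [← hM i (by omega) (n + j) (by omega)]
            exact h3 j hj)
        (by
          rintro M ⟨⟨h1, h2⟩, h3⟩ l hl hli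
          simp only [Set.mem_iInter, Finset.mem_range, Set.mem_ofPred_eq] at h3
          by_cases hln : l < n
          · exact hIa l hln hli (h2 l hln hli).2
          · have := h3 (l - n) (by omega)
            rwa [Nat.add_sub_cancel' (by omega)] at this)
      rw [hGsucc]
      refine le_trans ?_ step
      push_cast
      refine le_trans ?_ (mul_le_mul_of_nonneg_left ih
        (div_nonneg (by linarith) (by linarith)))
      have h1 : (m + (n - 1) : ℝ) ≠ 0 := by linarith
      have h2 : (n + m : ℝ) ≠ 0 := by linarith
      have h3 : (m + 1 + (n - 1) : ℝ) ≠ 0 := by linarith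
      refine le_of_eq ?_
      field_simp
      ring
  let K : ℕ → Set Mat := fun m => baseEvent n i I ∩ fitsEvent n i I (n + m) ∩
    ⋂ j ∈ Finset.range m, (fitsEvent n i I (n + j))ᶜ
  have hKm : ∀ m, MeasurableSet (K m) := fun m => (hB.inter (hF _)).inter
    (Finset.measurableSet_biInter _ fun j _ => (hF _).compl)
  have hKdisj : Pairwise (Function.onFun Disjoint K) := by
    refine (pairwise_disjoint_on K).2 fun m m' hmm => Set.disjoint_left.2 ?_
    rintro M ⟨⟨-, h1⟩, -⟩ ⟨-, h2⟩
    simp only [Set.mem_iInter, Finset.mem_range] at h2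
    exact h2 m hmm h1
  have hle : ∀ m, μ.real (G m) ≤ μ.real (K m) := by
    intro m
    rw [← map_real_preimage_swap h i (n + m) (hKm m)]
    refine ENNReal.toReal_mono (measure_ne_top _ _) (measure_mono_ae ?_)
    have hall : ∀ᵐ M ∂μ, ∀ j, M ∈ baseEvent n i I → M ∈ fitsEvent n i I i →
      M ∈ fitsEvent n i I (n + j) → ¬ M i (n + j) ≤ a :=
      ae_all_iff.2 fun j => hzero' (n + j) (by omega)
    filter_upwards [hall] with M hM
    rintro ⟨⟨h1, h2⟩, h3⟩
    simp only [Set.mem_iInter, Finset.mem_range, Set.mem_ofPred_eq] at h3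
    have hρ : ∀ l < n, l ≠ i → Equiv.swap i (n + m) l = l := fun l hl hli =>
      Equiv.swap_apply_of_ne_of_ne hli (by omega)
    refine ⟨⟨(permute_mem_baseEvent hρ M).2 h1, (permute_mem_fitsEvent hρ _ M).2 ?_⟩, ?_⟩
    · rwa [Equiv.swap_apply_right]
    · simp only [Set.mem_iInter, Finset.mem_range, Set.mem_compl_iff]
      intro j hj hfit
      rw [permute_mem_fitsEvent hρ,
        Equiv.swap_apply_of_ne_of_ne (by omega) (by omega)] at hfit
      exact hM j h1 h2 hfit (h3 j hj)
  have hsum : Summable fun m => μ.real (K m) :=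
    summable_measure_toReal hKm hKdisj
  refine not_summable_div_add ((n - 1) * μ.real (G 0)) ?_ (n - 1)
    (hsum.of_nonneg_of_le (fun m => ?_) fun m => (hlow m).trans (hle m))
  · have hn' : (2 : ℝ) ≤ n := by exact_mod_cast hn
    have : G 0 = baseEvent n i I ∩ fitsEvent n i I i := by simp [G]
    rw [this]
    exact mul_pos (by linarith) hpos
  · have hn' : (2 : ℝ) ≤ n := by exact_mod_cast hn
    have : (0 : ℝ) ≤ n - 1 := by linarith
    positivity

/-- The constraint that replicas with distinct residues modulo `3` have overlap prescribed by `U`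
and that replicas with equal residues have overlap at most the corresponding diagonal entry. -/
def residueConstraint (U : ℕ → ℕ → ℝ) (l l' : ℕ) : Set ℝ :=
  if l % 3 = l' % 3 then Set.Iic (U (l % 3) (l % 3)) else {U (l % 3) (l' % 3)}

lemma measurableSet_residueConstraint (U : ℕ → ℕ → ℝ) (l l' : ℕ) :
    MeasurableSet (residueConstraint U l l') := by
  unfold residueConstraint
  split_ifs
  exacts [measurableSet_Iic, measurableSet_singleton _]

/-- The first `n` replicas satisfy the residue constraints of `U`. -/
def residueEvent (U : ℕ → ℕ → ℝ) (n : ℕ) : Set Mat :=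
  {M | ∀ l < n, ∀ l' < n, l ≠ l' → M l l' ∈ residueConstraint U l l'}

lemma residueEvent_subset (U : ℕ → ℕ → ℝ) {n i : ℕ} (hi : i < n) :
    residueEvent U n ⊆ baseEvent n i (residueConstraint U) ∩
      fitsEvent n i (residueConstraint U) i :=
  fun _ hM => ⟨fun l hl l' hl' _ _ h => hM l hl l' hl' h,
    fun l hl hli => ⟨hM l hl i hi hli, hM i hi l hl hli.symm⟩⟩

lemma residueEvent_pos [IsProbabilityMeasure P] (h : IsGramDeFinetti P R) (hG : SatisfiesGGI P R)
    (hd : ∀ᵐ ω ∂P, ∀ l, R ω l l = 1) {U : ℕ → ℕ → ℝ}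
    (hU : ∀ r < 3, ∀ s < 3, U r s ≤ U r r)
    (hpos : 0 < (P.map R).real (residueEvent U 3)) (m : ℕ) :
    0 < (P.map R).real (residueEvent U (m + 3)) := by
  have := Measure.isProbabilityMeasure_map (μ := P) h.1.aemeasurable
  have hsymm : ∀ᵐ M ∂(P.map R), ∀ i j, M i j = M j i := by
    refine (ae_map_iff h.1.aemeasurable ?_).2 h.2.2.1
    simp only [Set.ofPred_forall]
    exact .iInter fun i => .iInter fun j =>
      measurableSet_eq_fun (measurable_entry i j) (measurable_entry j i)
  induction m with
  | zero => exact hpos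
  | succ m ih =>
    set n := m + 3 with hn
    set i := n % 3 with hi
    have hi3 : i < 3 := Nat.mod_lt _ (by norm_num)
    have hin : i < n := by omega
    have hii : i % 3 = i := Nat.mod_eq_of_lt hi3
    have hrow : ∀ l, residueConstraint U i l = residueConstraint U n l := by
      intro l
      simp only [residueConstraint, hii, ← hi]
    have hcol : ∀ l, residueConstraint U l i = residueConstraint U l n := by
      intro l
      simp only [residueConstraint, hii, ← hi]
    have hpos' := duplication h hG hd (by omega) hin (U i i)
      (measurableSet_residueConstraint U)
      (by
        intro l _ _ x hx
        unfold residueConstraint at hx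
        rw [hii] at hx
        split_ifs at hx
        · exact hx
        · rw [Set.mem_singleton_iff] at hx
          rw [hx]
          exact hU i hi3 _ (Nat.mod_lt _ (by norm_num)))
      (ih.trans_le (measureReal_mono (residueEvent_subset U hin)))
    refine hpos'.trans_le (ENNReal.toReal_mono (measure_ne_top _ _) (measure_mono_ae ?_))
    filter_upwards [hsymm] with M hM
    rintro ⟨⟨⟨h1, h2⟩, h3⟩, h4⟩
    have hnew : ∀ l < n, M l n ∈ residueConstraint U l n ∧ M n l ∈ residueConstraint U n l := by
      intro l hl
      by_cases hli : l = i
      · subst hli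
        rw [hM n i, ← hcol, ← hrow, and_self, residueConstraint, if_pos rfl, hii]
        exact h4
      · rw [← hcol, ← hrow]
        exact h3 l hl hli
    have hold : M ∈ residueEvent U n := by
      intro l hl l' hl' hll
      by_cases hli : l = i
      · subst hli
        exact (h2 l' hl' hll.symm).2
      by_cases hli' : l' = i
      · subst hli'
        exact (h2 l hl hll).1
      exact h1 l hl l' hl' hli hli' hll
    intro l hl l' hl' hll
    rcases Nat.lt_succ_iff_lt_or_eq.1 hl with hl | rfl <;>
      rcases Nat.lt_succ_iff_lt_or_eq.1 hl' with hl' | rfl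
    · exact hold l hl l' hl' hll
    · exact (hnew l hl).1
    · exact (hnew l' hl').2
    · exact absurd rfl hll

lemma sum_mod_three (g : ℕ → ℝ) (N : ℕ) :
    ∑ i ∈ Finset.range (3 * N), g (i % 3) = N * ∑ r ∈ Finset.range 3, g r := by
  induction N with
  | zero => simp
  | succ N ih =>
    rw [Nat.mul_succ, Finset.sum_range_add, ih]
    have : ∀ r ∈ Finset.range 3, g ((3 * N + r) % 3) = g r := fun r hr => by
      rw [Nat.mul_add_mod, Nat.mod_eq_of_lt (Finset.mem_range.1 hr)]
    rw [Finset.sum_congr rfl this]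
    push_cast
    ring

lemma quadratic_nonneg_of_residueEvent_pos (h : IsGramDeFinetti P R)
    (hd : ∀ᵐ ω ∂P, ∀ l, R ω l l = 1) {U : ℕ → ℕ → ℝ}
    (hpos : ∀ m, 0 < (P.map R).real (residueEvent U (m + 3))) (w : ℕ → ℝ) :
    0 ≤ ∑ r ∈ Finset.range 3, ∑ s ∈ Finset.range 3, w r * w s * U r s := by
  set Q := ∑ r ∈ Finset.range 3, ∑ s ∈ Finset.range 3, w r * w s * U r s with hQ
  set D := ∑ r ∈ Finset.range 3, w r * w r * (1 - U r r) with hD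
  have key : ∀ N : ℕ, 1 ≤ N → 0 ≤ N * Q + D := by
    intro N hN
    obtain ⟨m, hm⟩ : ∃ m, 3 * N = m + 3 := ⟨3 * N - 3, by omega⟩
    have hmeas : MeasurableSet (residueEvent U (3 * N)) := by
      simp only [residueEvent, Set.ofPred_forall]
      exact .iInter fun l => .iInter fun _ => .iInter fun l' => .iInter fun _ => .iInter fun _ =>
        measurableSet_entry l l' (measurableSet_residueConstraint U l l')
    have hposN := hpos m
    rw [← hm, map_measureReal_apply h.1 hmeas, measureReal_def, ENNReal.toReal_pos_iff] at hposN
    obtain ⟨ω, hω, hωd, hωp⟩ := Measure.exists_mem_of_measure_ne_zero_of_ae hposN.1.ne'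
      (ae_restrict_of_ae (hd.and h.2.2.2.1))
    have hq : 0 ≤ ∑ i ∈ Finset.range (3 * N), ∑ j ∈ Finset.range (3 * N),
        w (i % 3) * w (j % 3) * R ω i j := by
      have := hωp (3 * N) fun i => w (i % 3)
      rw [Finset.sum_range]
      simpa only [Finset.sum_range] using this
    have hterm : ∀ i ∈ Finset.range (3 * N), ∀ j ∈ Finset.range (3 * N),
        w (i % 3) * w (j % 3) * R ω i j ≤ w (i % 3) * w (j % 3) * U (i % 3) (j % 3) +
          if i = j then w (i % 3) * w (i % 3) * (1 - U (i % 3) (i % 3)) else 0 := by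
      intro i hi j hj
      split_ifs with hij
      · subst hij
        rw [hωd]
        linarith
      · have hmem := hω i (Finset.mem_range.1 hi) j (Finset.mem_range.1 hj) hij
        unfold residueConstraint at hmem
        split_ifs at hmem with hres
        · rw [← hres, add_zero]
          exact mul_le_mul_of_nonneg_left hmem (mul_self_nonneg _)
        · rw [Set.mem_singleton_iff.1 hmem, add_zero]
    have hle := hq.trans (Finset.sum_le_sum fun i hi => Finset.sum_le_sum (hterm i hi))
    have hrow : ∀ i ∈ Finset.range (3 * N), (∑ j ∈ Finset.range (3 * N),
        (w (i % 3) * w (j % 3) * U (i % 3) (j % 3) +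
          if i = j then w (i % 3) * w (i % 3) * (1 - U (i % 3) (i % 3)) else 0))
        = N * ∑ s ∈ Finset.range 3, w (i % 3) * w s * U (i % 3) s
          + w (i % 3) * w (i % 3) * (1 - U (i % 3) (i % 3)) := by
      intro i hi
      rw [Finset.sum_add_distrib, Finset.sum_ite_eq, if_pos hi,
        sum_mod_three (fun s => w (i % 3) * w s * U (i % 3) s)]
    rw [Finset.sum_congr rfl hrow, sum_mod_three (fun r =>
      N * ∑ s ∈ Finset.range 3, w r * w s * U r s + w r * w r * (1 - U r r)),
      Finset.sum_add_distrib, ← Finset.mul_sum, ← hQ, ← hD] at hle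
    exact nonneg_of_mul_nonneg_right hle (by exact_mod_cast hN)
  by_contra! hneg
  obtain ⟨N, hN⟩ := exists_nat_gt (D / -Q)
  rw [div_lt_iff₀ (by linarith)] at hN
  have := key (N + 1) (by omega)
  push_cast at this
  linarith

/-- The overlaps of three replicas, completed on the diagonal by the row maxima. -/
def tripleOverlap (a b c : ℝ) (r s : ℕ) : ℝ :=
  if r = s then (if r = 0 then max b c else if r = 1 then b else c)
  else if r + s = 1 then b else if r + s = 2 then c else a

lemma exists_quadratic_neg {a b c : ℝ} (hb : a < b) (hc : a < c) : ∃ w : ℕ → ℝ,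
    ∑ r ∈ Finset.range 3, ∑ s ∈ Finset.range 3, w r * w s * tripleOverlap a b c r s < 0 := by
  have aux : ∀ x : ℝ, a < x → ∃ e : ℝ, e * e * x - 2 * e * (x - a) < 0 := by
    intro x hx
    have h1 : 0 < |x| + 1 := by positivity
    have h2 : 0 < (x - a) / (|x| + 1) := div_pos (by linarith) h1
    refine ⟨(x - a) / (|x| + 1), ?_⟩
    set e := (x - a) / (|x| + 1) with he
    have h3 : e * (|x| + 1) = x - a := div_mul_cancel₀ _ h1.ne'
    rw [← h3]
    nlinarith [mul_pos h2 h2, mul_nonneg (mul_pos h2 h2).le (abs_nonneg x),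
      mul_le_mul_of_nonneg_left (le_abs_self x) (mul_pos h2 h2).le]
  rcases le_total b c with h | h
  · obtain ⟨e, he⟩ := aux b hb
    refine ⟨fun r => if r = 0 then 1 else if r = 1 then -e else -1, ?_⟩
    simp [Finset.sum_range_succ, tripleOverlap, max_eq_right h]
    linarith
  · obtain ⟨e, he⟩ := aux c hc
    refine ⟨fun r => if r = 0 then 1 else if r = 1 then -1 else -e, ?_⟩
    simp [Finset.sum_range_succ, tripleOverlap, max_eq_left h]
    linarith

lemma measure_nonultrametric_triple_eq_zero [IsProbabilityMeasure P]
    (h : IsGramDeFinetti P R) (hG : SatisfiesGGI P R)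
    (hd : ∀ᵐ ω ∂P, ∀ l, R ω l l = 1) {a b c : ℝ} (hb : a < b) (hc : a < c) :
    P {ω | R ω 0 1 = b ∧ R ω 0 2 = c ∧ R ω 1 2 = a} = 0 := by
  by_contra hne
  obtain ⟨w, hw⟩ := exists_quadratic_neg hb hc
  refine hw.not_ge (quadratic_nonneg_of_residueEvent_pos h hd (residueEvent_pos h hG hd ?_ ?_) w)
  · intro r hr s hs
    interval_cases r <;> interval_cases s <;> simp [tripleOverlap, hb.le, hc.le]
  · have := Measure.isProbabilityMeasure_map (μ := P) h.1.aemeasurable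
    refine ENNReal.toReal_pos (fun h0 => hne ?_) (measure_ne_top _ _)
    have h0' := ae_of_ae_map h.1.aemeasurable (measure_eq_zero_iff_ae_notMem.1 h0)
    refine measure_eq_zero_iff_ae_notMem.2 ?_
    filter_upwards [h0', h.2.2.1] with ω hω hs
    rintro ⟨h1, h2, h3⟩
    refine hω fun l hl l' hl' hll => ?_
    interval_cases l <;> interval_cases l' <;>
      simp_all [residueConstraint, tripleOverlap]

lemma ae_mem_of_finiteValueCondition [IsProbabilityMeasure P]
    {k : ℕ} {q m : ℕ → ℝ} (hk : 1 ≤ k) (hm : Measurable R)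
    (hFV : FiniteValueCondition P R k q m) :
    ∀ᵐ ω ∂P, R ω 0 1 ∈ q '' Finset.Icc 1 k := by
  obtain ⟨-, hq, -, -, hm1, hmk, hmono, hP⟩ := hFV
  have hqmono : StrictMonoOn q (Set.Icc 1 k) :=
    strictMonoOn_of_lt_succ Set.ordConnected_Icc fun l _ hl hl' => hq l hl.1 hl'.2
  have hmeas : ∀ l, MeasurableSet {ω | R ω 0 1 = q l} := fun l =>
    ((measurable_entry 0 1).comp hm) (measurableSet_singleton (q l))
  have hunion : {ω | R ω 0 1 ∈ q '' Finset.Icc 1 k} =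
      ⋃ l ∈ Finset.Icc 1 k, {ω | R ω 0 1 = q l} := by
    ext ω
    simp [eq_comm]
  have hnn : ∀ l ∈ Finset.Icc 1 k, 0 ≤ m (l + 1) - m l := fun l hl => by
    rw [Finset.mem_Icc] at hl
    linarith [hmono l hl.1 hl.2]
  refine mem_ae_iff_prob_eq_one₀ ?_ |>.2 ?_
  · rw [hunion]
    exact (Finset.measurableSet_biUnion _ fun l _ => hmeas l).nullMeasurableSet
  · rw [hunion, measure_biUnion_finset ?_ fun l _ => hmeas l,
      Finset.sum_congr rfl fun l hl => hP l (Finset.mem_Icc.1 hl).1 (Finset.mem_Icc.1 hl).2,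
      ← ENNReal.ofReal_sum_of_nonneg hnn, ← Finset.Ico_add_one_right_eq_Icc,
      Finset.sum_Ico_sub m (by omega), hmk, hm1, sub_zero, ENNReal.ofReal_one]
    intro l hl l' hl' hll
    refine Set.disjoint_left.2 fun ω h1 h2 => hll ?_
    rw [Finset.coe_Icc] at hl hl'
    exact hqmono.injOn hl hl' (h1.symm.trans h2)

lemma ae_swap [IsProbabilityMeasure P] (h : IsGramDeFinetti P R) (i j : ℕ) {p : Mat → Prop}
    (hp : MeasurableSet {M | p M}) (hae : ∀ᵐ ω ∂P, p (R ω)) :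
    ∀ᵐ ω ∂P, p (permute (Equiv.swap i j) (R ω)) := by
  refine ae_of_ae_map h.1.aemeasurable
    (ae_of_ae_map (measurable_permute (Equiv.swap i j)).aemeasurable ?_)
  rw [map_permute_swap h i j]
  exact (ae_map_iff h.1.aemeasurable hp).2 hae

end Overlaps

/-- **Theorem 1.** A Gram–de Finetti matrix satisfying the Ghirlanda–Guerra
identities and the finite-value condition is ultrametric:
`P(R_{2,3} ≥ min (R_{1,2}, R_{1,3})) = 1`. -/
theorem ultrametricity {Ω : Type*} [MeasurableSpace Ω] (P : Measure Ω)
    [IsProbabilityMeasure P] (R : Ω → Mat) (k : ℕ) (hk : 1 ≤ k) (q m : ℕ → ℝ)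
    (hGdF : IsGramDeFinetti P R) (hGGI : SatisfiesGGI P R)
    (hFV : FiniteValueCondition P R k q m) :
    P {ω | min (R ω 0 1) (R ω 0 2) ≤ R ω 1 2} = 1 := by
  have hd := hFV.1
  have hv := ae_mem_of_finiteValueCondition hk hGdF.1 hFV
  have hfin : MeasurableSet (q '' Finset.Icc 1 k) :=
    ((Finset.finite_toSet _).image q).measurableSet
  have hv' : ∀ᵐ ω ∂P, R ω 0 2 ∈ q '' Finset.Icc 1 k :=
    ae_swap hGdF 1 2 (p := fun M => M 0 1 ∈ q '' Finset.Icc 1 k)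
      (measurableSet_entry 0 1 hfin) hv
  have hv'' : ∀ᵐ ω ∂P, R ω 1 2 ∈ q '' Finset.Icc 1 k :=
    ae_swap hGdF 0 1 (p := fun M => M 0 2 ∈ q '' Finset.Icc 1 k)
      (measurableSet_entry 0 2 hfin) hv'
  have hbad : ∀ᵐ ω ∂P, ∀ l₁ l₂ l₃, q l₃ < q l₁ → q l₃ < q l₂ →
      ¬ (R ω 0 1 = q l₁ ∧ R ω 0 2 = q l₂ ∧ R ω 1 2 = q l₃) := by
    simp only [ae_all_iff]
    intro l₁ l₂ l₃ h1 h2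
    exact measure_eq_zero_iff_ae_notMem.1
      (measure_nonultrametric_triple_eq_zero hGdF hGGI hd h1 h2)
  have hmeas : MeasurableSet {ω | min (R ω 0 1) (R ω 0 2) ≤ R ω 1 2} :=
    hGdF.1 (measurableSet_le ((measurable_entry 0 1).min (measurable_entry 0 2))
      (measurable_entry 1 2))
  refine (mem_ae_iff_prob_eq_one₀ hmeas.nullMeasurableSet).1 ?_
  filter_upwards [hv, hv', hv'', hbad] with ω ⟨l₁, _, h1⟩ ⟨l₂, _, h2⟩ ⟨l₃, _, h3⟩ hω
  by_contra hlt
  obtain ⟨hlt1, hlt2⟩ := lt_min_iff.1 (not_le.1 hlt)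
  exact hω l₁ l₂ l₃ (by rwa [h3, h1]) (by rwa [h3, h2]) ⟨h1.symm, h2.symm, h3.symm⟩

end
end

section
/- Suppose R is a Gram–de Finetti matrix satisfying the Ghirlanda–Guerra identities and the finite-value condition. Then ultrametricity holds at the last level: P(R_{1,2} ≥ q_k and R_{1,3} ≥ q_k and R_{2,3} < q_k) = 0. -/
open MeasureTheory ProbabilityTheory

noncomputable section

/-- If countably many events have the same positive probability, then for every `n` some `n` of
them occur simultaneously with positive probability. -/
lemma exists_finset_measure_biInter_ne_zero {Ω : Type*} [MeasurableSpace Ω] (P : Measure Ω)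
    [IsFiniteMeasure P] (A : ℕ → Set Ω) (hA : ∀ t, MeasurableSet (A t)) {c : ENNReal}
    (hc : c ≠ 0) (h : ∀ t, P (A t) = c) (n : ℕ) :
    ∃ s : Finset ℕ, s.card = n ∧ P (⋂ t ∈ s, A t) ≠ 0 := by
  by_contra! H
  have hnull : P (⋃ s : {s : Finset ℕ // s.card = n}, ⋂ t ∈ s.1, A t) = 0 :=
    measure_iUnion_null fun s => H s.1 s.2
  have hsub : (⋂ N, ⋃ t ∈ Set.Ici N, A t) ⊆
      ⋃ s : {s : Finset ℕ // s.card = n}, ⋂ t ∈ s.1, A t := by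
    intro ω hω
    have hinf : {t | ω ∈ A t}.Infinite := by
      refine Set.infinite_of_forall_exists_gt fun N => ?_
      obtain ⟨t, ht, hωt⟩ := Set.mem_iUnion₂.1 (Set.mem_iInter.1 hω (N + 1))
      exact ⟨t, hωt, ht⟩
    obtain ⟨s, hs, hcard⟩ := hinf.exists_subset_card_eq n
    exact Set.mem_iUnion.2 ⟨⟨s, hcard⟩, Set.mem_iInter₂.2 fun t ht => hs ht⟩
  have hle : c ≤ P (⋂ N, ⋃ t ∈ Set.Ici N, A t) := by
    rw [Antitone.measure_iInter]
    · refine le_iInf fun N => ?_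
      rw [← h N]
      exact measure_mono (Set.subset_biUnion_of_mem (u := A) (Set.mem_Ici.2 le_rfl))
    · intro N N' hN
      exact Set.biUnion_subset_biUnion_left (Set.Ici_subset_Ici.2 hN)
    · exact fun N => (MeasurableSet.biUnion (Set.to_countable _) fun t _ => hA t).nullMeasurableSet
    · exact ⟨0, measure_ne_top _ _⟩
  exact hc (le_zero_iff.1 (hle.trans ((measure_mono hsub).trans hnull.le)))

/-- Membership in `S` is determined by the top-left `N × N` submatrix. -/
def DependsOnCorner (N : ℕ) (S : Set Mat) : Prop :=
  ∀ M M' : Mat, (∀ i < N, ∀ j < N, M i j = M' i j) → M ∈ S → M' ∈ S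

/-- Relabelling two indices of a weakly exchangeable matrix preserves probabilities of events
determined by finitely many entries. -/
lemma measure_swap_eq {Ω : Type*} [MeasurableSpace Ω] {P : Measure Ω} {R : Ω → Mat}
    (hR : IsGramDeFinetti P R) {N : ℕ} {S : Set Mat} (hS : MeasurableSet S)
    (hN : DependsOnCorner N S) (a b : ℕ) :
    P {ω | (fun i j => R ω (Equiv.swap a b i) (Equiv.swap a b j)) ∈ S} = P {ω | R ω ∈ S} := by
  obtain ⟨hmeas, -, -, -, hex⟩ := hR
  obtain ⟨L, hNL, haL, hbL⟩ : ∃ L, N ≤ L ∧ a < L ∧ b < L :=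
    ⟨max N (max a b + 1), by omega, by omega, by omega⟩
  let pad : (Fin L → Fin L → ℝ) → Mat := fun A i j =>
    if h : i < L ∧ j < L then A ⟨i, h.1⟩ ⟨j, h.2⟩ else 0
  have hpad : Measurable pad := by
    refine measurable_pi_lambda _ fun i => measurable_pi_lambda _ fun j => ?_
    by_cases h : i < L ∧ j < L
    · simp only [pad, h, and_self, dite_true]
      fun_prop
    · simp only [pad, h, dite_false]
      fun_prop
  have hentry : ∀ i j, Measurable fun ω => R ω i j := fun i j =>
    (measurable_pi_apply j).comp ((measurable_pi_apply i).comp hmeas)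
  have key := congrArg (fun ν => ν (pad ⁻¹' S)) (hex L (Equiv.swap ⟨a, haL⟩ ⟨b, hbL⟩))
  rw [Measure.map_apply (measurable_pi_lambda _ fun i => measurable_pi_lambda _ fun j =>
      hentry _ _) (hpad hS),
    Measure.map_apply (measurable_pi_lambda _ fun i => measurable_pi_lambda _ fun j =>
      hentry _ _) (hpad hS)] at key
  have hval : ∀ x : Fin L, ((Equiv.swap (⟨a, haL⟩ : Fin L) ⟨b, hbL⟩ x : Fin L) : ℕ)
      = Equiv.swap a b (x : ℕ) := by
    intro x
    simp only [Equiv.swap_apply_def, Fin.ext_iff]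
    split_ifs <;> rfl
  convert key using 2
  · ext ω
    simp only [Set.mem_ofPred_eq, Set.mem_preimage]
    refine ⟨hN _ _ fun i hi j hj => ?_, hN _ _ fun i hi j hj => ?_⟩ <;>
    simp [pad, hval, hi.trans_le hNL, hj.trans_le hNL]
  · ext ω
    simp only [Set.mem_ofPred_eq, Set.mem_preimage]
    refine ⟨hN _ _ fun i hi j hj => ?_, hN _ _ fun i hi j hj => ?_⟩ <;>
    simp [pad, hi.trans_le hNL, hj.trans_le hNL]

/-- If an event determined by the first `N` indices has positive probability, then with positive
probability it holds simultaneously for `n` fresh copies of the index `a`. -/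
lemma exists_fresh_copies {Ω : Type*} [MeasurableSpace Ω] {P : Measure Ω} [IsFiniteMeasure P]
    {R : Ω → Mat} (hR : IsGramDeFinetti P R) {N : ℕ} {S : Set Mat} (hS : MeasurableSet S)
    (hN : DependsOnCorner N S) (hpos : P {ω | R ω ∈ S} ≠ 0) (a n : ℕ) :
    ∃ T : Finset ℕ, T.card = n ∧ (∀ t ∈ T, N ≤ t) ∧
      P {ω | ∀ t ∈ T, (fun i j => R ω (Equiv.swap a t i) (Equiv.swap a t j)) ∈ S} ≠ 0 := by
  have hmeas : ∀ t, MeasurableSet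
      {ω | (fun i j => R ω (Equiv.swap a (N + t) i) (Equiv.swap a (N + t) j)) ∈ S} := by
    intro t
    refine measurableSet_preimage (measurable_pi_lambda _ fun i =>
      measurable_pi_lambda _ fun j => ?_) hS
    exact (measurable_pi_apply _).comp ((measurable_pi_apply _).comp hR.1)
  obtain ⟨s, hs, hP⟩ := exists_finset_measure_biInter_ne_zero P _ hmeas hpos
    (fun t => measure_swap_eq hR hS hN a (N + t)) n
  refine ⟨s.map (addLeftEmbedding N), by simpa using hs, by simp, ?_⟩
  convert hP using 2
  ext ω
  simp

/-- The matrices whose entries `(i, j)` and `(i, l)` are at least `x` while the entry `(j, l)` is at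
most `y`. -/
def cherry (x y : ℝ) (i j l : ℕ) : Set Mat := {M | x ≤ M i j ∧ x ≤ M i l ∧ M j l ≤ y}

lemma measurableSet_cherry (x y : ℝ) (i j l : ℕ) : MeasurableSet (cherry x y i j l) := by
  have h : ∀ i j, Measurable fun M : Mat => M i j := fun i j =>
    (measurable_pi_apply j).comp (measurable_pi_apply i)
  exact (measurableSet_le measurable_const (h _ _)).inter
    ((measurableSet_le measurable_const (h _ _)).inter
      (measurableSet_le (h _ _) measurable_const))

lemma dependsOnCorner_cherry {N : ℕ} {x y : ℝ} {i j l : ℕ} (hi : i < N) (hj : j < N)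
    (hl : l < N) : DependsOnCorner N (cherry x y i j l) := by
  intro M M' h hM
  simpa only [cherry, Set.mem_ofPred_eq, h i hi j hj, h i hi l hl, h j hj l hl] using hM

/-- A cherry pattern of positive probability can be blown up to arbitrarily large groups. -/
lemma exists_cherry_blowup {Ω : Type*} [MeasurableSpace Ω] {P : Measure Ω} [IsFiniteMeasure P]
    {R : Ω → Mat} (hR : IsGramDeFinetti P R) {x y : ℝ}
    (hpos : P {ω | R ω ∈ cherry x y 0 1 2} ≠ 0) (n : ℕ) :
    ∃ I J K : Finset ℕ, I.card = n ∧ J.card = n ∧ K.card = n ∧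
      P {ω | ∀ i ∈ I, ∀ j ∈ J, ∀ l ∈ K, R ω ∈ cherry x y i j l} ≠ 0 := by
  obtain ⟨K, hK, hK3, hKpos⟩ := exists_fresh_copies hR (measurableSet_cherry x y 0 1 2)
    (dependsOnCorner_cherry (N := 3) (by omega) (by omega) (by omega)) hpos 2 n
  have hKlt : ∀ l ∈ K, l < K.sup id + 3 := fun l hl =>
    (Finset.le_sup (f := id) hl).trans_lt (by omega)
  have hKpos' : P {ω | R ω ∈ ⋂ l ∈ K, cherry x y 0 1 l} ≠ 0 := by
    convert hKpos using 2
    ext ω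
    simp only [Set.mem_ofPred_eq, Set.mem_iInter]
    refine forall₂_congr fun l hl => ?_
    have := hK3 l hl
    simp only [cherry, Set.mem_ofPred_eq, Equiv.swap_apply_left,
      Equiv.swap_apply_of_ne_of_ne (show (0 : ℕ) ≠ 2 by omega) (show 0 ≠ l by omega),
      Equiv.swap_apply_of_ne_of_ne (show (1 : ℕ) ≠ 2 by omega) (show 1 ≠ l by omega)]
  obtain ⟨J, hJ, hJN, hJpos⟩ := exists_fresh_copies hR (N := K.sup id + 3)
    (K.measurableSet_biInter fun l _ => measurableSet_cherry x y 0 1 l)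
    (fun M M' h hM => Set.mem_iInter₂.2 fun l hl => dependsOnCorner_cherry (by omega) (by omega)
      (hKlt l hl) M M' h (Set.mem_iInter₂.1 hM l hl)) hKpos' 1 n
  have hJlt : ∀ j ∈ J, j < J.sup id + K.sup id + 3 := fun j hj =>
    (Finset.le_sup (f := id) hj).trans_lt (by omega)
  have hJpos' : P {ω | R ω ∈ ⋂ j ∈ J, ⋂ l ∈ K, cherry x y 0 j l} ≠ 0 := by
    convert hJpos using 2
    ext ω
    simp only [Set.mem_ofPred_eq, Set.mem_iInter]
    refine forall₂_congr fun j hj => forall₂_congr fun l hl => ?_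
    have := hK3 l hl
    have := hJN j hj
    have := hKlt l hl
    simp only [cherry, Set.mem_ofPred_eq, Equiv.swap_apply_left,
      Equiv.swap_apply_of_ne_of_ne (show (0 : ℕ) ≠ 1 by omega) (show 0 ≠ j by omega),
      Equiv.swap_apply_of_ne_of_ne (show l ≠ 1 by omega) (show l ≠ j by omega)]
  obtain ⟨I, hI, hIN, hIpos⟩ := exists_fresh_copies hR (N := J.sup id + K.sup id + 3)
    (J.measurableSet_biInter fun j _ =>
      K.measurableSet_biInter fun l _ => measurableSet_cherry x y 0 j l)
    (fun M M' h hM => Set.mem_iInter₂.2 fun j hj => Set.mem_iInter₂.2 fun l hl =>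
      dependsOnCorner_cherry (by omega) (hJlt j hj) ((hKlt l hl).trans_le (by omega)) M M' h
        (Set.mem_iInter₂.1 (Set.mem_iInter₂.1 hM j hj) l hl)) hJpos' 0 n
  refine ⟨I, J, K, hI, hJ, hK, ?_⟩
  convert hIpos using 2
  ext ω
  simp only [Set.mem_ofPred_eq, Set.mem_iInter]
  refine forall₂_congr fun i hi => forall₂_congr fun j hj => forall₂_congr fun l hl => ?_
  have := hK3 l hl
  have := hJN j hj
  have := hKlt l hl
  have := hJlt j hj
  have := hIN i hi
  simp only [cherry, Set.mem_ofPred_eq, Equiv.swap_apply_left,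
    Equiv.swap_apply_of_ne_of_ne (show j ≠ 0 by omega) (show j ≠ i by omega),
    Equiv.swap_apply_of_ne_of_ne (show l ≠ 0 by omega) (show l ≠ i by omega)]

/-- The quadratic form of a positive semidefinite array at `2 • 1_I - 1_J - 1_K`. -/
lemma sum_indicator_form_nonneg {M : Mat}
    (hpsd : ∀ (n : ℕ) (c : Fin n → ℝ), 0 ≤ ∑ i : Fin n, ∑ j : Fin n, c i * c j * M i j)
    (I J K : Finset ℕ) :
    0 ≤ 4 * (∑ i ∈ I, ∑ j ∈ I, M i j) + (∑ i ∈ J, ∑ j ∈ J, M i j) + (∑ i ∈ K, ∑ j ∈ K, M i j)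
      - 2 * (∑ i ∈ I, ∑ j ∈ J, M i j) - 2 * (∑ i ∈ J, ∑ j ∈ I, M i j)
      - 2 * (∑ i ∈ I, ∑ j ∈ K, M i j) - 2 * (∑ i ∈ K, ∑ j ∈ I, M i j)
      + (∑ i ∈ J, ∑ j ∈ K, M i j) + (∑ i ∈ K, ∑ j ∈ J, M i j) := by
  classical
  obtain ⟨N, hI, hJ, hK⟩ : ∃ N, I ⊆ Finset.range N ∧ J ⊆ Finset.range N ∧ K ⊆ Finset.range N := by
    obtain ⟨N, hN⟩ := (I ∪ J ∪ K).exists_nat_subset_range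
    exact ⟨N, fun a ha => hN (by simp [ha]), fun a ha => hN (by simp [ha]),
      fun a ha => hN (by simp [ha])⟩
  let e : Finset ℕ → ℕ → ℝ := fun s a => if a ∈ s then 1 else 0
  have hform : ∀ s t : Finset ℕ, s ⊆ Finset.range N → t ⊆ Finset.range N →
      ∑ i ∈ s, ∑ j ∈ t, M i j
        = ∑ i ∈ Finset.range N, ∑ j ∈ Finset.range N, e s i * e t j * M i j := by
    intro s t hs ht
    rw [← Finset.sum_subset hs]
    · refine Finset.sum_congr rfl fun i hi => ?_
      rw [← Finset.sum_subset ht]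
      · exact Finset.sum_congr rfl fun j hj => by simp [e, hi, hj]
      · intro j _ hj
        simp [e, hj]
    · intro i _ hi
      simp [e, hi]
  let c : ℕ → ℝ := fun a => 2 * e I a - e J a - e K a
  have h : 0 ≤ ∑ i ∈ Finset.range N, ∑ j ∈ Finset.range N, c i * c j * M i j := by
    rw [← Fin.sum_univ_eq_sum_range (fun i => ∑ j ∈ Finset.range N, c i * c j * M i j)]
    exact (hpsd N fun i => c i).trans_eq (Finset.sum_congr rfl fun i _ =>
      Fin.sum_univ_eq_sum_range (fun j => c i * c j * M i j) N)
  rw [hform I I hI hI, hform J J hJ hJ, hform K K hK hK, hform I J hI hJ, hform J I hJ hI,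
    hform I K hI hK, hform K I hK hI, hform J K hJ hK, hform K J hK hJ]
  simp only [Finset.mul_sum, ← Finset.sum_add_distrib, ← Finset.sum_sub_distrib]
  refine h.trans_eq (Finset.sum_congr rfl fun i _ => Finset.sum_congr rfl fun j _ => ?_)
  simp only [c]
  ring

lemma sum_sum_le_of_forall_le {M : Mat} {s t : Finset ℕ} {n : ℕ} (hs : s.card = n)
    (ht : t.card = n) {x : ℝ} (h : ∀ i ∈ s, ∀ j ∈ t, M i j ≤ x) :
    ∑ i ∈ s, ∑ j ∈ t, M i j ≤ n * (n * x) := by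
  rw [← nsmul_eq_mul, ← nsmul_eq_mul]
  nth_rw 1 [← hs]
  refine Finset.sum_le_card_nsmul _ _ _ fun i hi => ?_
  rw [← ht]
  exact Finset.sum_le_card_nsmul _ _ _ fun j hj => h i hi j hj

lemma le_sum_sum_of_forall_le {M : Mat} {s t : Finset ℕ} {n : ℕ} (hs : s.card = n)
    (ht : t.card = n) {x : ℝ} (h : ∀ i ∈ s, ∀ j ∈ t, x ≤ M i j) :
    n * (n * x) ≤ ∑ i ∈ s, ∑ j ∈ t, M i j := by
  rw [← nsmul_eq_mul, ← nsmul_eq_mul]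
  nth_rw 1 [← hs]
  refine Finset.card_nsmul_le_sum _ _ _ fun i hi => ?_
  rw [← ht]
  exact Finset.card_nsmul_le_sum _ _ _ fun j hj => h i hi j hj

/-- The sum of the entries of an `n × n` principal submatrix with ones on the diagonal and
off-diagonal entries at most `x`. -/
lemma sum_sum_principal_le {M : Mat} {s : Finset ℕ} {n : ℕ} (hs : s.card = n) {x : ℝ}
    (hx : 0 ≤ x) (hdiag : ∀ i, M i i = 1) (hoff : ∀ i j, i ≠ j → M i j ≤ x) :
    ∑ i ∈ s, ∑ j ∈ s, M i j ≤ n * (n * x) + n := by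
  classical
  have h := sum_sum_le_of_forall_le (M := fun i j => M i j - if i = j then 1 else 0) hs hs
    (x := x) fun i _ j _ => by
      by_cases hij : i = j
      · simpa [hij, hdiag] using hx
      · simpa [hij] using hoff i j hij
  simp only [Finset.sum_sub_distrib, Finset.sum_ite_eq, Finset.sum_ite_mem, Finset.inter_self,
    Finset.sum_const, hs, nsmul_eq_mul, mul_one] at h
  linarith

/-- A unit-diagonal positive semidefinite array with off-diagonal entries at most `x` contains no
cherry blown up to groups of size `n > 3 / δ`. -/
lemma not_cherry_blowup {M : Mat} (hsymm : ∀ i j, M i j = M j i)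
    (hpsd : ∀ (n : ℕ) (c : Fin n → ℝ), 0 ≤ ∑ i : Fin n, ∑ j : Fin n, c i * c j * M i j)
    (hdiag : ∀ i, M i i = 1) {x δ : ℝ} (hx : 0 ≤ x) (hoff : ∀ i j, i ≠ j → M i j ≤ x)
    {n : ℕ} (hn : 3 < n * δ) {I J K : Finset ℕ} (hI : I.card = n) (hJ : J.card = n)
    (hK : K.card = n) (h : ∀ i ∈ I, ∀ j ∈ J, ∀ l ∈ K, M ∈ cherry x (x - δ) i j l) : False := by
  have hn0 : 0 < n := Nat.pos_of_ne_zero fun h0 => by norm_num [h0] at hn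
  obtain ⟨i₀, hi₀⟩ := Finset.card_pos.1 (hI ▸ hn0)
  obtain ⟨j₀, hj₀⟩ := Finset.card_pos.1 (hJ ▸ hn0)
  obtain ⟨l₀, hl₀⟩ := Finset.card_pos.1 (hK ▸ hn0)
  have hIJ : ∀ i ∈ I, ∀ j ∈ J, x ≤ M i j := fun i hi j hj => (h i hi j hj l₀ hl₀).1
  have hIK : ∀ i ∈ I, ∀ l ∈ K, x ≤ M i l := fun i hi l hl => (h i hi j₀ hj₀ l hl).2.1
  have hJK : ∀ j ∈ J, ∀ l ∈ K, M j l ≤ x - δ := fun j hj l hl => (h i₀ hi₀ j hj l hl).2.2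
  have hform := sum_indicator_form_nonneg hpsd I J K
  have h1 := sum_sum_principal_le hI hx hdiag hoff
  have h2 := sum_sum_principal_le hJ hx hdiag hoff
  have h3 := sum_sum_principal_le hK hx hdiag hoff
  have h4 := le_sum_sum_of_forall_le hI hJ hIJ
  have h5 := le_sum_sum_of_forall_le hJ hI fun j hj i hi => hsymm i j ▸ hIJ i hi j hj
  have h6 := le_sum_sum_of_forall_le hI hK hIK
  have h7 := le_sum_sum_of_forall_le hK hI fun l hl i hi => hsymm i l ▸ hIK i hi l hl
  have h8 := sum_sum_le_of_forall_le hJ hK hJK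
  have h9 := sum_sum_le_of_forall_le hK hJ fun l hl j hj => hsymm j l ▸ hJK j hj l hl
  have hn1 : (0 : ℝ) < n := by exact_mod_cast hn0
  nlinarith

lemma FiniteValueCondition.le_last {Ω : Type*} [MeasurableSpace Ω] {P : Measure Ω} {R : Ω → Mat}
    {k : ℕ} {q m : ℕ → ℝ} (hFV : FiniteValueCondition P R k q m) {l : ℕ} (h1 : 1 ≤ l)
    (hl : l ≤ k) : q l ≤ q k := by
  obtain ⟨-, hq, -⟩ := hFV
  induction k, hl using Nat.le_induction with
  | base => exact le_rfl
  | succ n hn ih =>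
    exact (ih fun l h h' => hq l h (by omega)).trans (hq n (by omega) (by omega)).le

/-- Under the finite-value condition the entry `(0, 1)` is almost surely at most the largest
value. -/
lemma FiniteValueCondition.measure_last_lt {Ω : Type*} [MeasurableSpace Ω] {P : Measure Ω}
    [IsProbabilityMeasure P] {R : Ω → Mat} (hR : Measurable R) {k : ℕ} {q m : ℕ → ℝ}
    (hFV : FiniteValueCondition P R k q m) : P {ω | q k < R ω 0 1} = 0 := by
  have hle := fun l => hFV.le_last (l := l)
  obtain ⟨-, hq, -, -, hm1, hmk, hm, hP⟩ := hFV
  have hentry : Measurable fun ω => R ω 0 1 :=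
    (measurable_pi_apply 1).comp ((measurable_pi_apply 0).comp hR)
  have hmono : ∀ l l', 1 ≤ l → l < l' → l' ≤ k → q l < q l' := by
    intro l l' h1 hl
    induction l', hl using Nat.le_induction with
    | base => exact fun h => hq l h1 h
    | succ n hn ih => exact fun h => (ih (by omega)).trans (hq n (by omega) (by omega))
  have hmeas : ∀ l, MeasurableSet {ω | R ω 0 1 = q l} := fun l =>
    hentry (measurableSet_singleton (q l))
  have hone : P (⋃ l ∈ Finset.Ico 1 (k + 1), {ω | R ω 0 1 = q l}) = 1 := by
    rw [measure_biUnion_finset _ fun l _ => hmeas l]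
    · rw [Finset.sum_congr rfl fun l hl => hP l (Finset.mem_Ico.1 hl).1
        (Nat.lt_succ_iff.1 (Finset.mem_Ico.1 hl).2), ← ENNReal.ofReal_sum_of_nonneg,
        Finset.sum_Ico_sub m (by omega), hm1, hmk]
      · simp
      · intro l hl
        have := Finset.mem_Ico.1 hl
        exact sub_nonneg.2 (hm l this.1 (by omega)).le
    · intro l hl l' hl' hne
      have h1 := Finset.mem_Ico.1 hl
      have h2 := Finset.mem_Ico.1 hl'
      refine Set.disjoint_left.2 fun ω hω hω' => ?_
      have heq : q l = q l' := hω.symm.trans hω'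
      rcases hne.lt_or_gt with h | h
      · exact (hmono l l' h1.1 h (by omega)).ne heq
      · exact (hmono l' l h2.1 h (by omega)).ne' heq
  have hcompl := (prob_compl_eq_zero_iff
    (Finset.measurableSet_biUnion _ fun l _ => hmeas l)).2 hone
  refine measure_mono_null ?_ hcompl
  intro ω hω hω'
  obtain ⟨l, hl, hωl⟩ := Set.mem_iUnion₂.1 hω'
  have h1 := Finset.mem_Ico.1 hl
  have h2 := hle l h1.1 (by omega)
  have h3 : q k < R ω 0 1 := hω
  have h4 : R ω 0 1 = q l := hωl
  linarith

lemma IsGramDeFinetti.measure_lt_eq {Ω : Type*} [MeasurableSpace Ω] {P : Measure Ω}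
    {R : Ω → Mat} (hR : IsGramDeFinetti P R) (x : ℝ) {i j : ℕ} (hij : i ≠ j) :
    P {ω | x < R ω i j} = P {ω | x < R ω 0 1} := by
  have hmeas : ∀ i j, MeasurableSet {M : Mat | x < M i j} := fun i j =>
    measurableSet_lt measurable_const ((measurable_pi_apply j).comp (measurable_pi_apply i))
  have hcorner : ∀ i j, DependsOnCorner (max i j + 1) {M : Mat | x < M i j} := by
    intro i j M M' h hM
    simpa only [Set.mem_ofPred_eq, h i (by omega) j (by omega)] using hM
  have h1 := measure_swap_eq hR (hmeas i j) (hcorner i j) i 0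
  set b := Equiv.swap i 0 j with hb
  have hb0 : b ≠ 0 := fun h => hij <| by
    rw [hb, Equiv.swap_apply_eq_iff, Equiv.swap_apply_right] at h
    exact h.symm
  have h2 := measure_swap_eq hR (hmeas 0 b) (hcorner 0 b) b 1
  simp only [Set.mem_ofPred_eq, Equiv.swap_apply_left, ← hb,
    Equiv.swap_apply_of_ne_of_ne hb0.symm zero_ne_one] at h1 h2
  rw [← h1, ← h2]

/-- Ultrametricity at the last level: a Gram–de Finetti matrix satisfying the
Ghirlanda–Guerra identities and the finite-value condition satisfies
`P(R_{1,2} ≥ q_k, R_{1,3} ≥ q_k, R_{2,3} < q_k) = 0`. -/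
theorem ultrametricity_last_level {Ω : Type*} [MeasurableSpace Ω] (P : Measure Ω)
    [IsProbabilityMeasure P] (R : Ω → Mat) (k : ℕ) (hk : 1 ≤ k) (q m : ℕ → ℝ)
    (hGdF : IsGramDeFinetti P R) (hGGI : SatisfiesGGI P R)
    (hFV : FiniteValueCondition P R k q m) :
    P {ω | q k ≤ R ω 0 1 ∧ q k ≤ R ω 0 2 ∧ R ω 1 2 < q k} = 0 := by
  have hq0 : 0 ≤ q k := hFV.2.2.1.trans (hFV.le_last le_rfl hk)
  have hoff : ∀ᵐ ω ∂P, ∀ i j, i ≠ j → R ω i j ≤ q k := by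
    refine ae_all_iff.2 fun i => ae_all_iff.2 fun j => ?_
    by_cases hij : i = j
    · exact .of_forall fun ω h => absurd hij h
    · have h := (hGdF.measure_lt_eq (q k) hij).trans (hFV.measure_last_lt hGdF.1)
      filter_upwards [measure_eq_zero_iff_ae_notMem.1 h] with ω hω _ using not_lt.1 hω
  have hnull : ∀ δ > 0, P {ω | R ω ∈ cherry (q k) (q k - δ) 0 1 2} = 0 := by
    intro δ hδ
    by_contra hpos
    obtain ⟨n, hn⟩ := exists_nat_gt (3 / δ)
    obtain ⟨I, J, K, hI, hJ, hK, hIJK⟩ := exists_cherry_blowup hGdF hpos n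
    refine hIJK (measure_eq_zero_iff_ae_notMem.2 ?_)
    filter_upwards [hoff, hGdF.2.2.1, hGdF.2.2.2.1, hFV.1] with ω hle hsymm hpsd hdiag hω
    exact not_cherry_blowup hsymm hpsd hdiag hq0 hle ((div_lt_iff₀ hδ).1 hn) hI hJ hK hω
  refine measure_mono_null (fun ω hω => ?_)
    (measure_iUnion_null fun n : ℕ => hnull (1 / ((n : ℝ) + 1)) Nat.one_div_pos_of_nat)
  obtain ⟨h1, h2, h3⟩ := hω
  obtain ⟨n, hn⟩ := exists_nat_one_div_lt (sub_pos.2 h3)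
  exact Set.mem_iUnion.2 ⟨n, h1, h2, by linarith⟩

end
end

section
/- Let A ⊆ [−1,1] be a Borel set with F(A) > 0. Then for Pr-almost all ω, for μ_ω-almost all x₁ ∈ H, μ_ω({x₂ ∈ H : x₁ · x₂ ∈ A}) > 0. -/
open MeasureTheory ProbabilityTheory RealInnerProductSpace

noncomputable section

variable {H : Type*} [NormedAddCommGroup H] [InnerProductSpace ℝ H]
  [TopologicalSpace.SeparableSpace H] [MeasurableSpace H] [BorelSpace H]

/-- The Gram matrix (plus diagonal perturbation) generated by a sequence in `H × ℝ`. -/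
def genMat (x : ℕ → H × ℝ) : Mat :=
  fun i j => ⟪(x i).1, (x j).1⟫ + if i = j then (x i).2 else 0

/-- `ν` is the law of an i.i.d. sequence with marginal `η`: all finite-dimensional
cylinder probabilities are products. -/
def IsIIDFrom (ν : Measure (ℕ → H × ℝ)) (η : Measure (H × ℝ)) : Prop :=
  ∀ (n : ℕ) (A : Fin n → Set (H × ℝ)), (∀ i, MeasurableSet (A i)) →
    ν {x | ∀ i : Fin n, x (i : ℕ) ∈ A i} = ∏ i : Fin n, η (A i)

/-- The recursion `m (n + 1) = (1 - q / n) m n` with `q > 0` admits no positive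
lower bound, because the harmonic series diverges. -/
lemma nonpos_of_le_harmonic_recursion {m : ℕ → ℝ} {q c : ℝ} (hq : 0 < q)
    (hm : ∀ n, 2 ≤ n → m (n + 1) = m n - q / n * m n) (hc : ∀ n, c ≤ m n) : c ≤ 0 := by
  by_contra! hc0
  have key : ∀ n : ℕ, m (n + 2) ≤ m 2 - q * c * ∑ i ∈ Finset.range n, 1 / ((i + 2 : ℕ) : ℝ) := by
    intro n
    induction n with
    | zero => simp
    | succ n ih =>
      have h1 := hm (n + 2) (by omega)
      have h2 : q / ((n + 2 : ℕ) : ℝ) * c ≤ q / ((n + 2 : ℕ) : ℝ) * m (n + 2) :=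
        mul_le_mul_of_nonneg_left (hc _) (by positivity)
      have h3 : q * c * (1 / ((n + 2 : ℕ) : ℝ)) = q / ((n + 2 : ℕ) : ℝ) * c := by ring
      rw [Finset.sum_range_succ, mul_add, h3, show n + 1 + 2 = n + 2 + 1 by ring, h1]
      linarith
  have hsum : Summable fun i : ℕ => 1 / ((i + 2 : ℕ) : ℝ) := by
    refine summable_of_sum_range_le (c := m 2 / (q * c)) (fun _ => by positivity) fun n => ?_
    rw [le_div_iff₀ (by positivity)]
    linarith [key n, hc (n + 2)]
  exact Real.not_summable_one_div_natCast
    ((summable_nat_add_iff (f := fun i : ℕ => 1 / (i : ℝ)) 2).1 hsum)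

/-- The event that the entries `M 0 l`, `1 ≤ l < n`, all lie in `B`. -/
def rowEvent (B : Set ℝ) (n : ℕ) : Set Mat := {M | ∀ l, 1 ≤ l → l < n → M 0 l ∈ B}

lemma measurableSet_rowEvent {B : Set ℝ} (hB : MeasurableSet B) (n : ℕ) :
    MeasurableSet (rowEvent B n) := by
  have : rowEvent B n = ⋂ l, ⋂ (_ : 1 ≤ l), ⋂ (_ : l < n), (fun M : Mat => M 0 l) ⁻¹' B := by
    ext M; simp [rowEvent]
  rw [this]
  refine MeasurableSet.iInter fun l => MeasurableSet.iInter fun _ => MeasurableSet.iInter fun _ => ?_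
  exact (by fun_prop : Measurable fun M : Mat => M 0 l) hB

/-- The Ghirlanda–Guerra identities give a recursion for the probabilities of `rowEvent`. -/
lemma SatisfiesGGI.measureReal_rowEvent_succ {Ω : Type*} [MeasurableSpace Ω] {P : Measure Ω}
    [IsProbabilityMeasure P] {R : Ω → Mat} (hR : Measurable R) (h : SatisfiesGGI P R)
    {A : Set ℝ} (hA : MeasurableSet A) {n : ℕ} (hn : 2 ≤ n) :
    P.real (R ⁻¹' rowEvent Aᶜ (n + 1)) = P.real (R ⁻¹' rowEvent Aᶜ n) -
      P.real ((fun ω => R ω 0 1) ⁻¹' A) / n * P.real (R ⁻¹' rowEvent Aᶜ n) := by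
  classical
  let T : Set ({p : Fin n × Fin n // p.1 < p.2} → ℝ) :=
    {x | ∀ p, (p.1.1 : ℕ) = 0 → x p ∈ Aᶜ}
  have hT : MeasurableSet T := by
    have : T = ⋂ p : {p : Fin n × Fin n // p.1 < p.2}, ⋂ (_ : (p.1.1 : ℕ) = 0),
        (fun x : {p : Fin n × Fin n // p.1 < p.2} → ℝ => x p) ⁻¹' Aᶜ := by
      ext x; simp [T]
    rw [this]
    exact MeasurableSet.iInter fun p => MeasurableSet.iInter fun _ => measurable_pi_apply p hA.compl
  have hTmem : ∀ M : Mat, subU n M ∈ T ↔ M ∈ rowEvent Aᶜ n := by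
    intro M
    constructor
    · intro hM l hl hln
      exact hM ⟨(⟨0, by omega⟩, ⟨l, hln⟩), by simp [Fin.lt_def]; omega⟩ rfl
    · rintro hM ⟨⟨i, j⟩, hij⟩ hi
      have hi' : (i : ℕ) = 0 := hi
      have hij' : (i : ℕ) < j := hij
      have := hM j (by omega) j.2
      simpa [subU, hi'] using this
  have hbound : ∀ {α : Type} (s : Set α), ∃ C, ∀ x, |s.indicator (1 : α → ℝ) x| ≤ C := by
    intro α s
    refine ⟨1, fun x => ?_⟩
    by_cases hx : x ∈ s <;> simp [hx]
  have hint : ∀ k, ∫ ω, (rowEvent Aᶜ k).indicator (1 : Mat → ℝ) (R ω) ∂P =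
      P.real (R ⁻¹' rowEvent Aᶜ k) := fun k =>
    integral_indicator_one (hR (measurableSet_rowEvent hA.compl k))
  have hf : ∀ ω, T.indicator (1 : ({p : Fin n × Fin n // p.1 < p.2} → ℝ) → ℝ) (subU n (R ω)) =
      (rowEvent Aᶜ n).indicator (1 : Mat → ℝ) (R ω) := by
    intro ω
    simp [Set.indicator_apply, hTmem]
  have hlast : ∀ ω, (rowEvent Aᶜ n).indicator (1 : Mat → ℝ) (R ω) *
      Aᶜ.indicator (1 : ℝ → ℝ) (R ω 0 n) =
        (rowEvent Aᶜ (n + 1)).indicator (1 : Mat → ℝ) (R ω) := by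
    intro ω
    have : R ω ∈ rowEvent Aᶜ (n + 1) ↔ R ω ∈ rowEvent Aᶜ n ∧ R ω 0 n ∈ Aᶜ := by
      constructor
      · intro hM
        exact ⟨fun l h1 h2 => hM l h1 (by omega), hM n (by omega) (by omega)⟩
      · rintro ⟨hM, hMn⟩ l h1 h2
        rcases Nat.lt_succ_iff_lt_or_eq.1 h2 with h3 | rfl
        · exact hM l h1 h3
        · exact hMn
    simp only [Set.indicator_apply, this, Pi.one_apply]
    by_cases h1 : R ω ∈ rowEvent Aᶜ n <;> by_cases h2 : R ω 0 n ∈ Aᶜ <;> simp [h1, h2]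
  have hprev : ∀ l ∈ Finset.Ico 1 n, ∫ ω, (rowEvent Aᶜ n).indicator (1 : Mat → ℝ) (R ω) *
      Aᶜ.indicator (1 : ℝ → ℝ) (R ω 0 l) ∂P = P.real (R ⁻¹' rowEvent Aᶜ n) := by
    intro l hl
    rw [← hint n]
    congr 1 with ω
    obtain ⟨h1, h2⟩ := Finset.mem_Ico.1 hl
    by_cases hM : R ω ∈ rowEvent Aᶜ n
    · rw [Set.indicator_of_mem (hM l h1 h2)]; simp
    · simp [hM]
  have hR01 : Measurable fun ω => R ω 0 1 := by fun_prop
  have hψ : ∫ ω, Aᶜ.indicator (1 : ℝ → ℝ) (R ω 0 1) ∂P =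
      1 - P.real ((fun ω => R ω 0 1) ⁻¹' A) := by
    rw [← probReal_compl_eq_one_sub (hR01 hA)]
    exact integral_indicator_one (hR01 hA.compl)
  have hgg := h n hn (T.indicator 1) (measurable_one.indicator hT) (hbound T)
    (Aᶜ.indicator 1) (measurable_one.indicator hA.compl) (hbound _)
  simp only [hf, hlast] at hgg
  rw [Finset.sum_congr rfl hprev, hψ, hint, hint, Finset.sum_const, Nat.card_Ico, nsmul_eq_mul,
    Nat.cast_sub (by omega)] at hgg
  rw [hgg]
  have : (n : ℝ) ≠ 0 := by positivity
  field_simp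
  push_cast
  ring

lemma measurable_genMat : Measurable (genMat : (ℕ → H × ℝ) → Mat) := by
  have : SecondCountableTopology H := UniformSpace.secondCountable_of_separable H
  refine measurable_pi_lambda _ fun i => measurable_pi_lambda _ fun j => ?_
  unfold genMat
  split_ifs <;> fun_prop

/-- Two distinct coordinates of an i.i.d. sequence have the product law. -/
lemma IsIIDFrom.map_prodMk {ν : Measure (ℕ → H × ℝ)} {η : Measure (H × ℝ)}
    [IsProbabilityMeasure η] (h : IsIIDFrom ν η) {l : ℕ} (hl : 1 ≤ l) :
    ν.map (fun x => (x 0, x l)) = η.prod η := by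
  refine (Measure.prod_eq fun s t hs ht => ?_).symm
  rw [Measure.map_apply (by fun_prop) (hs.prod ht)]
  have h' := h (l + 1) (fun i => if (i : ℕ) = 0 then s else if (i : ℕ) = l then t else Set.univ)
    (fun i => by split_ifs <;> simp [hs, ht])
  have hset : {x : ℕ → H × ℝ | ∀ i : Fin (l + 1), x i ∈
      (if (i : ℕ) = 0 then s else if (i : ℕ) = l then t else Set.univ)} =
      (fun x => (x 0, x l)) ⁻¹' s ×ˢ t := by
    ext x
    simp only [Set.mem_ofPred_eq, Set.mem_preimage, Set.mem_prod]
    constructor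
    · intro hx
      have h0 := hx 0
      have h1 := hx (Fin.last l)
      simp only [Fin.val_zero, Fin.val_last, if_true, if_neg (by omega : ¬ l = 0)] at h0 h1
      exact ⟨h0, h1⟩
    · rintro ⟨h0, h1⟩ i
      split_ifs with hi hi'
      · rwa [hi]
      · rwa [hi']
      · trivial
  rw [hset] at h'
  rw [h', Fin.prod_univ_succ]
  obtain ⟨k, rfl⟩ : ∃ k, l = k + 1 := ⟨l - 1, by omega⟩
  rw [Fin.prod_univ_castSucc, Finset.prod_eq_one]
  · simp
  · intro i _
    have : (i : ℕ) ≠ k := i.2.ne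
    simp [this]

/-- The points whose overlaps with an independent sample almost surely avoid `A` contribute to the
event that a whole row of overlaps avoids `A`. -/
lemma IsIIDFrom.measure_null_overlap_le
    {ν : Measure (ℕ → H × ℝ)} {η : Measure (H × ℝ)}
    [IsProbabilityMeasure η] (h : IsIIDFrom ν η) {A : Set ℝ} (hA : MeasurableSet A) :
    η.map Prod.fst {x | η.map Prod.fst {y | ⟪x, y⟫ ∈ A} = 0} ≤
      ν {x | ∀ l, 1 ≤ l → genMat x 0 l ∈ Aᶜ} := by
  have : SecondCountableTopology H := UniformSpace.secondCountable_of_separable H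
  have : IsProbabilityMeasure (η.map Prod.fst) :=
    Measure.isProbabilityMeasure_map measurable_fst.aemeasurable
  have hinner : MeasurableSet {p : H × H | ⟪p.1, p.2⟫ ∈ A} :=
    (by fun_prop : Measurable fun p : H × H => ⟪p.1, p.2⟫) hA
  set S : Set H := {x | η.map Prod.fst {y | ⟪x, y⟫ ∈ A} = 0}
  have hS : MeasurableSet S :=
    (measurable_measure_prodMk_left (ν := η.map Prod.fst) hinner) (measurableSet_singleton 0)
  have hnull : ∀ l, 1 ≤ l → ν {x | (x 0).1 ∈ S ∧ ⟪(x 0).1, (x l).1⟫ ∈ A} = 0 := by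
    intro l hl
    let W : Set ((H × ℝ) × (H × ℝ)) := {p | p.1.1 ∈ S ∧ ⟪p.1.1, p.2.1⟫ ∈ A}
    have hW : MeasurableSet W :=
      (measurable_fst.fst hS).inter
        ((by fun_prop : Measurable fun p : (H × ℝ) × (H × ℝ) => ⟪p.1.1, p.2.1⟫) hA)
    have h1 : ν {x | (x 0).1 ∈ S ∧ ⟪(x 0).1, (x l).1⟫ ∈ A} = (η.prod η) W := by
      rw [← h.map_prodMk hl, Measure.map_apply (by fun_prop) hW]
      rfl
    rw [h1, Measure.measure_prod_null hW]
    refine Filter.Eventually.of_forall fun p => ?_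
    by_cases hp : p.1 ∈ S
    · have h2 : η.map Prod.fst ((fun y : H => ⟪p.1, y⟫) ⁻¹' A) = 0 := hp
      rw [Measure.map_apply measurable_fst
        ((by fun_prop : Measurable fun y : H => ⟪p.1, y⟫) hA)] at h2
      exact measure_mono_null (fun q hq => hq.2) h2
    · have : Prod.mk p ⁻¹' W = ∅ := by
        ext q; simp [W, hp]
      simp [this]
  have hmarg : η.map Prod.fst S = ν {x | (x 0).1 ∈ S} := by
    have hc : MeasurableSet ((Prod.fst : H × ℝ → H) ⁻¹' S) := measurable_fst hS
    have h1 : ν {x | (x 0).1 ∈ S} = (η.prod η) ((Prod.fst ⁻¹' S) ×ˢ Set.univ) := by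
      rw [← h.map_prodMk le_rfl, Measure.map_apply (by fun_prop) (hc.prod MeasurableSet.univ)]
      congr 1
      ext x
      simp
    rw [h1, Measure.prod_prod, measure_univ, mul_one, Measure.map_apply measurable_fst hS]
  rw [hmarg]
  refine measure_mono_ae ?_
  have hall : ∀ᵐ x ∂ν, ∀ l, 1 ≤ l → ¬ ((x 0).1 ∈ S ∧ ⟪(x 0).1, (x l).1⟫ ∈ A) := by
    refine ae_all_iff.2 fun l => ?_
    by_cases hl : 1 ≤ l
    · filter_upwards [measure_eq_zero_iff_ae_notMem.1 (hnull l hl)] with x hx _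
      exact hx
    · exact Filter.Eventually.of_forall fun x hx => absurd hx hl
  filter_upwards [hall] with x hx hxS l hl
  have hl0 : ¬ (0 = l) := by omega
  simpa [genMat, hl0] using fun hmem => hx l hl ⟨hxS, hmem⟩

/-- Lemma 1(a): if `F(A) > 0` then for almost all `ω`, for `μ_ω`-almost all `x₁`,
`μ_ω(x₂ : x₁ · x₂ ∈ A) > 0`, where `μ_ω` is the directing measure of the
Dovbysh–Sudakov representation and `F` is the law of `R_{1,2}`. -/
theorem directing_measure_positive_overlap
    {Ω₁ Ω : Type*} [MeasurableSpace Ω₁] [MeasurableSpace Ω]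
    (P : Measure Ω₁) [IsProbabilityMeasure P] (Pr : Measure Ω) [IsProbabilityMeasure Pr]
    (R : Ω₁ → Mat) (hGdF : IsGramDeFinetti P R) (hGGI : SatisfiesGGI P R)
    (η : Kernel Ω (H × ℝ)) [IsMarkovKernel η]
    (hpos : ∀ ω, η ω {p | p.2 < 0} = 0)
    (ν : Kernel Ω (ℕ → H × ℝ)) [IsMarkovKernel ν]
    (hiid : ∀ ω, IsIIDFrom (ν ω) (η ω))
    (hrep : ∀ A : Set Mat, MeasurableSet A →
      Measure.map R P A = ∫⁻ ω, Measure.map genMat (ν ω) A ∂Pr)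
    (μ : Ω → Measure H) (hμ : ∀ ω, μ ω = (η ω).map Prod.fst)
    (F : Measure ℝ) (hF : F = Measure.map (fun ω₁ => R ω₁ 0 1) P)
    (A : Set ℝ) (hA : MeasurableSet A) (hFA : 0 < F A) :
    ∀ᵐ ω ∂Pr, ∀ᵐ x₁ ∂(μ ω), 0 < μ ω {x₂ | ⟪x₁, x₂⟫ ∈ A} := by
  subst hF
  have hR := hGdF.1
  have hR01 : Measurable fun ω => R ω 0 1 := by fun_prop
  rw [Measure.map_apply hR01 hA] at hFA
  have hq : 0 < P.real ((fun ω => R ω 0 1) ⁻¹' A) :=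
    ENNReal.toReal_pos hFA.ne' (measure_ne_top _ _)
  let E : Set Mat := {M | ∀ l, 1 ≤ l → M 0 l ∈ Aᶜ}
  have hE : MeasurableSet E := by
    have : E = ⋂ l, ⋂ (_ : 1 ≤ l), (fun M : Mat => M 0 l) ⁻¹' Aᶜ := by
      ext M; simp [E]
    rw [this]
    exact MeasurableSet.iInter fun l => MeasurableSet.iInter fun _ =>
      (by fun_prop : Measurable fun M : Mat => M 0 l) hA.compl
  have hPE : P (R ⁻¹' E) = 0 := by
    refine (measureReal_eq_zero_iff).1 (le_antisymm ?_ measureReal_nonneg)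
    refine nonpos_of_le_harmonic_recursion (m := fun n => P.real (R ⁻¹' rowEvent Aᶜ n)) hq
      (fun n hn => hGGI.measureReal_rowEvent_succ hR hA hn) fun n => ?_
    exact measureReal_mono fun ω hω l h1 _ => hω l h1
  have hrepE := hrep E hE
  simp only [Measure.map_apply hR hE, Measure.map_apply measurable_genMat hE, hPE] at hrepE
  have hae := (lintegral_eq_zero_iff (ν.measurable_coe (measurable_genMat hE))).1 hrepE.symm
  filter_upwards [hae] with ω hω
  rw [hμ ω]
  have hle := (hiid ω).measure_null_overlap_le hA
  have hzero : (η ω).map Prod.fst {x | (η ω).map Prod.fst {y | ⟪x, y⟫ ∈ A} = 0} = 0 :=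
    le_antisymm (hle.trans hω.le) zero_le
  filter_upwards [measure_eq_zero_iff_ae_notMem.1 hzero] with x hx
  exact pos_iff_ne_zero.2 hx

end
end

section
/- Let A ⊆ [−1,1] be a Borel set and let m = P(R_{1,2} ∉ A). Then for every n ≥ 1, P(R_{1,l} ∉ A for all 2 ≤ l ≤ n+1) = (1/n!) ∏_{j=0}^{n−1} (j + m). Consequently, if m < 1 then P(R_{1,l} ∉ A for all l ≥ 2) = 0. -/
open MeasureTheory ProbabilityTheory

noncomputable section

/-- The product `∏_{j<n} (j + m) / n!` tends to `0` when `0 ≤ m < 1`. -/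
theorem tendsto_prod_add_div_factorial {m : ℝ} (h0 : 0 ≤ m) (h1 : m < 1) :
    Filter.Tendsto (fun n : ℕ => (∏ j ∈ Finset.range n, ((j : ℝ) + m)) / n.factorial)
      Filter.atTop (nhds 0) := by
  have key : ∀ n : ℕ, (∏ j ∈ Finset.range n, ((j : ℝ) + m)) / n.factorial
      ≤ Real.exp (-((1 - m) * ∑ i ∈ Finset.range n, 1 / ((i : ℝ) + 1))) := by
    intro n
    rw [← Finset.prod_range_add_one_eq_factorial, Nat.cast_prod, ← Finset.prod_div_distrib,
      Finset.mul_sum, ← Finset.sum_neg_distrib, Real.exp_sum]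
    refine Finset.prod_le_prod (fun j _ => by positivity) fun j _ => ?_
    have hj : (0 : ℝ) < (j : ℝ) + 1 := by positivity
    have h : ((j : ℝ) + m) / ((j + 1 : ℕ) : ℝ) = -((1 - m) * (1 / ((j : ℝ) + 1))) + 1 := by
      push_cast
      field_simp
      ring
    rw [h]
    exact Real.add_one_le_exp _
  refine squeeze_zero (fun n => ?_) key ?_
  · exact div_nonneg (Finset.prod_nonneg fun j _ => by positivity) (by positivity)
  · exact Real.tendsto_exp_neg_atTop_nhds_zero.comp
      (Real.tendsto_sum_range_one_div_nat_succ_atTop.const_mul_atTop (sub_pos.2 h1))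

/-- The event that the first `n` off-diagonal entries of the first row avoid `A`. -/
def avoidEvent {Ω : Type*} (R : Ω → Mat) (A : Set ℝ) (n : ℕ) : Set Ω :=
  {ω | ∀ l, 1 ≤ l → l ≤ n → R ω 0 l ∉ A}

theorem measurableSet_avoidEvent {Ω : Type*} [MeasurableSpace Ω] {R : Ω → Mat}
    (hR : Measurable R) {A : Set ℝ} (hA : MeasurableSet A) (n : ℕ) :
    MeasurableSet (avoidEvent R A n) := by
  have h : avoidEvent R A n
      = ⋂ l : ℕ, ⋂ _ : 1 ≤ l, ⋂ _ : l ≤ n, (fun ω => R ω 0 l) ⁻¹' Aᶜ := by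
    ext ω
    simp [avoidEvent]
  rw [h]
  exact .iInter fun l => .iInter fun _ => .iInter fun _ =>
    ((measurable_pi_apply l).comp ((measurable_pi_apply 0).comp hR)) hA.compl

theorem avoidEvent_succ {Ω : Type*} (R : Ω → Mat) (A : Set ℝ) (n : ℕ) :
    avoidEvent R A (n + 1) = avoidEvent R A n ∩ {ω | R ω 0 (n + 1) ∉ A} := by
  ext ω
  simp only [avoidEvent, Set.mem_ofPred_eq, Set.mem_inter_iff]
  refine ⟨fun h => ⟨fun l h1 h2 => h l h1 (by omega), h _ (by omega) le_rfl⟩, ?_⟩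
  rintro ⟨h, h'⟩ l h1 h2
  rcases Nat.lt_or_ge n l with hl | hl
  · obtain rfl : l = n + 1 := by omega
    exact h'
  · exact h l h1 hl

theorem subU_mem_iff_mem_avoidEvent {Ω : Type*} (R : Ω → Mat) (A : Set ℝ) (n : ℕ) (ω : Ω) :
    subU (n + 1) (R ω) ∈ {x : {p : Fin (n + 1) × Fin (n + 1) // p.1 < p.2} → ℝ |
        ∀ p, p.1.1 = 0 → x p ∉ A} ↔ ω ∈ avoidEvent R A n := by
  constructor
  · intro h l h1 h2
    exact h ⟨(0, ⟨l, by omega⟩), Nat.lt_of_succ_le h1⟩ rfl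
  · rintro h ⟨⟨i, j⟩, hij⟩ hi
    obtain rfl : i = 0 := hi
    exact h j (Nat.succ_le_of_lt hij)
      (by omega)

/-- The Ghirlanda–Guerra recursion for avoidance probabilities. -/
theorem SatisfiesGGI.measureReal_avoidEvent_succ {Ω : Type*} [MeasurableSpace Ω]
    {P : Measure Ω} {R : Ω → Mat} (hGGI : SatisfiesGGI P R)
    (hR : Measurable R) {A : Set ℝ} (hA : MeasurableSet A) {n : ℕ} (hn : 1 ≤ n) :
    P.real (avoidEvent R A (n + 1))
      = P.real (avoidEvent R A n) * ((n + P.real {ω | R ω 0 1 ∉ A}) / (n + 1)) := by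
  have hE := measurableSet_avoidEvent hR hA
  have hentry : ∀ l : ℕ, MeasurableSet {ω | R ω 0 l ∉ A} := fun l =>
    ((measurable_pi_apply l).comp ((measurable_pi_apply 0).comp hR)) hA.compl
  let S : Set ({p : Fin (n + 1) × Fin (n + 1) // p.1 < p.2} → ℝ) :=
    {x | ∀ p, p.1.1 = 0 → x p ∉ A}
  have hS : MeasurableSet S := by
    have h : S = ⋂ p : {p : Fin (n + 1) × Fin (n + 1) // p.1 < p.2},
        ⋂ _ : p.1.1 = 0, (fun x => x p) ⁻¹' Aᶜ := by
      ext x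
      simp [S]
    rw [h]
    exact .iInter fun p => .iInter fun _ => measurable_pi_apply p hA.compl
  have hbdd : ∀ {α : Type} (s : Set α), ∃ C, ∀ x, |s.indicator (1 : α → ℝ) x| ≤ C :=
    fun s => ⟨1, fun x => by by_cases hx : x ∈ s <;> simp [hx]⟩
  have hf : ∀ ω, S.indicator 1 (subU (n + 1) (R ω))
      = (avoidEvent R A n).indicator (1 : Ω → ℝ) ω := fun ω => by
    classical
    simp only [Set.indicator_apply, Pi.one_apply]
    exact if_congr (subU_mem_iff_mem_avoidEvent R A n ω) rfl rfl
  have hψ : ∀ l ω, Aᶜ.indicator (1 : ℝ → ℝ) (R ω 0 l)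
      = {ω | R ω 0 l ∉ A}.indicator 1 ω := fun l ω => by
    classical
    simp [Set.indicator_apply]
  have hmul : ∀ l ω, (avoidEvent R A n).indicator (1 : Ω → ℝ) ω
      * {ω | R ω 0 l ∉ A}.indicator 1 ω
      = (avoidEvent R A n ∩ {ω | R ω 0 l ∉ A}).indicator 1 ω := fun l ω => by
    rw [Set.inter_indicator_one, Pi.mul_apply]
  have h := hGGI (n + 1) (by omega) (S.indicator 1) (measurable_one.indicator hS) (hbdd S)
    (Aᶜ.indicator 1) (measurable_one.indicator hA.compl) (hbdd _)
  simp only [hf, hψ, hmul] at h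
  have hsum : ∀ l ∈ Finset.Ico 1 (n + 1),
      ∫ ω, (avoidEvent R A n ∩ {ω | R ω 0 l ∉ A}).indicator (1 : Ω → ℝ) ω ∂P
        = P.real (avoidEvent R A n) := fun l hl => by
    rw [Finset.mem_Ico] at hl
    rw [Set.inter_eq_left.2 (show avoidEvent R A n ⊆ {ω | R ω 0 l ∉ A} from
        fun ω hω => hω l hl.1 (by omega)), integral_indicator_one (hE n)]
  rw [Finset.sum_congr rfl hsum, integral_indicator_one ((hE n).inter (hentry _)),
    integral_indicator_one (hE n), integral_indicator_one (hentry 1), ← avoidEvent_succ,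
    Finset.sum_const, Nat.card_Ico, nsmul_eq_mul] at h
  rw [h, Nat.add_sub_cancel]
  push_cast
  field_simp
  ring

/-- For a Gram–de Finetti matrix satisfying the Ghirlanda–Guerra identities
and a Borel set `A ⊆ [-1,1]`, with `m = P(R_{1,2} ∉ A)` we have, for every
`n ≥ 1`, `P(R_{1,l} ∉ A for all 2 ≤ l ≤ n+1) = (1/n!) ∏_{j=0}^{n-1} (j + m)`;
consequently if `m < 1` then `P(R_{1,l} ∉ A for all l ≥ 2) = 0`. -/
theorem ggi_avoidance_probability {Ω : Type*} [MeasurableSpace Ω] (P : Measure Ω)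
    [IsProbabilityMeasure P] (R : Ω → Mat)
    (hGdF : IsGramDeFinetti P R) (hGGI : SatisfiesGGI P R)
    (A : Set ℝ) (hA : MeasurableSet A) (hA1 : A ⊆ Set.Icc (-1 : ℝ) 1)
    (mA : ℝ) (hmA : mA = (P {ω | R ω 0 1 ∉ A}).toReal) :
    (∀ n : ℕ, 1 ≤ n →
      P {ω | ∀ l, 1 ≤ l → l ≤ n → R ω 0 l ∉ A}
        = ENNReal.ofReal ((∏ j ∈ Finset.range n, ((j : ℝ) + mA)) / n.factorial)) ∧
    (mA < 1 → P {ω | ∀ l, 1 ≤ l → R ω 0 l ∉ A} = 0) := by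
  have hR := hGdF.1
  have hm : mA = P.real {ω | R ω 0 1 ∉ A} := hmA
  have hm0 : 0 ≤ mA := hm ▸ measureReal_nonneg
  have hreal : ∀ n : ℕ, 1 ≤ n → P.real (avoidEvent R A n)
      = (∏ j ∈ Finset.range n, ((j : ℝ) + mA)) / n.factorial := by
    intro n hn
    induction n, hn using Nat.le_induction with
    | base =>
      have h : avoidEvent R A 1 = {ω | R ω 0 1 ∉ A} := by
        ext ω
        exact ⟨fun h => h 1 le_rfl le_rfl, fun h l h1 h2 => le_antisymm h2 h1 ▸ h⟩
      simp [h, hm]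
    | succ n hn ih =>
      rw [hGGI.measureReal_avoidEvent_succ hR hA hn, ih, ← hm, Finset.prod_range_succ,
        Nat.factorial_succ]
      push_cast
      field_simp
  have hmeas : ∀ n : ℕ, 1 ≤ n → P (avoidEvent R A n)
      = ENNReal.ofReal ((∏ j ∈ Finset.range n, ((j : ℝ) + mA)) / n.factorial) :=
    fun n hn => by rw [← hreal n hn, ofReal_measureReal]
  refine ⟨hmeas, fun hm1 => le_antisymm ?_ zero_le⟩
  have hlim := ENNReal.tendsto_ofReal (tendsto_prod_add_div_factorial hm0 hm1)
  rw [ENNReal.ofReal_zero] at hlim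
  refine ge_of_tendsto hlim (Filter.eventually_atTop.2 ⟨1, fun n hn => ?_⟩)
  rw [← hmeas n hn]
  exact measure_mono fun ω hω l h1 _ => hω l h1

end
end

section
/- Let q* be the largest point of the support of F. Then for Pr-almost all ω, μ_ω({x ∈ H : ‖x‖² = q*}) = 1, i.e. the directing measure concentrates on the sphere of radius √q*. -/
open MeasureTheory ProbabilityTheory RealInnerProductSpace

noncomputable section

variable {H : Type*} [NormedAddCommGroup H] [InnerProductSpace ℝ H]
  [TopologicalSpace.SeparableSpace H] [MeasurableSpace H] [BorelSpace H]

/-- For an i.i.d. sequence whose off-diagonal overlaps are almost surely at most `q`, the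
marginal is supported in the ball of squared radius `q`. -/
lemma IsIIDFrom.ae_sq_norm_le {ν : Measure (ℕ → H × ℝ)} {η : Measure (H × ℝ)}
    (h : IsIIDFrom ν η) {q : ℝ} (hq : ν {x | q < ⟪(x 0).1, (x 1).1⟫} = 0) :
    η.map Prod.fst {x | q < ‖x‖ ^ 2} = 0 := by
  have : SecondCountableTopology H := UniformSpace.secondCountable_of_separable H
  refine measure_null_of_locally_null _ fun x hx => ?_
  have hcont : Continuous fun p : H × H => ⟪p.1, p.2⟫ := continuous_inner
  have hopen : IsOpen {p : H × H | q < ⟪p.1, p.2⟫} := isOpen_lt continuous_const hcont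
  have hmem : {p : H × H | q < ⟪p.1, p.2⟫} ∈ nhds (x, x) := by
    refine hopen.mem_nhds ?_
    simpa [real_inner_self_eq_norm_sq] using hx
  rw [nhds_prod_eq, Filter.mem_prod_same_iff] at hmem
  obtain ⟨t, ht, hts⟩ := hmem
  obtain ⟨U, hUt, hU, hxU⟩ := mem_nhds_iff.1 ht
  refine ⟨U, mem_nhdsWithin_of_mem_nhds (hU.mem_nhds hxU), ?_⟩
  rw [Measure.map_apply measurable_fst hU.measurableSet]
  have hprod := h 2 (fun _ => Prod.fst ⁻¹' U) fun _ => measurable_fst hU.measurableSet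
  have hzero : ν {y | ∀ i : Fin 2, y (i : ℕ) ∈ Prod.fst ⁻¹' U} = 0 := by
    refine measure_mono_null (fun y hy => ?_) hq
    exact hts (Set.mk_mem_prod (hUt (hy 0)) (hUt (hy 1)))
  rw [hzero, Finset.prod_const] at hprod
  exact pow_eq_zero_iff (by simp) |>.1 hprod.symm

/-- For an i.i.d. sequence in the ball of squared radius `q`, if the first point has squared norm
below `q - ε`, then all its overlaps are at most `q - ε / 2`. -/
lemma IsIIDFrom.measure_sq_norm_lt_le {ν : Measure (ℕ → H × ℝ)} {η : Measure (H × ℝ)}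
    [IsProbabilityMeasure η] (h : IsIIDFrom ν η) {q ε : ℝ}
    (hq : η.map Prod.fst {x | q < ‖x‖ ^ 2} = 0) (n : ℕ) :
    η.map Prod.fst {x | ‖x‖ ^ 2 < q - ε} ≤
      ν.map genMat {M | ∀ l ∈ Finset.Ico 1 (n + 1), M 0 l ≤ q - ε / 2} := by
  have hnorm : Measurable fun x : H => ‖x‖ ^ 2 := by fun_prop
  have hA : MeasurableSet {x : H | ‖x‖ ^ 2 < q - ε} := measurableSet_lt hnorm measurable_const
  have hB : MeasurableSet {x : H | ‖x‖ ^ 2 ≤ q} := measurableSet_le hnorm measurable_const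
  have hS : MeasurableSet {M : Mat | ∀ l ∈ Finset.Ico 1 (n + 1), M 0 l ≤ q - ε / 2} := by
    refine MeasurableSet.congr (s := ⋂ l ∈ Finset.Ico 1 (n + 1), {M : Mat | M 0 l ≤ q - ε / 2})
      (Finset.measurableSet_biInter _ fun l _ => measurableSet_le (by fun_prop) measurable_const) ?_
    ext M; simp
  have hB1 : η (Prod.fst ⁻¹' {x : H | ‖x‖ ^ 2 ≤ q}) = 1 := by
    rw [prob_compl_eq_zero_iff (measurable_fst hB) |>.symm]
    rw [Measure.map_apply measurable_fst (measurableSet_lt measurable_const hnorm)] at hq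
    convert hq using 2
    ext p; simp
  have hprod := h (n + 1) (Fin.cons (Prod.fst ⁻¹' {x : H | ‖x‖ ^ 2 < q - ε})
    fun _ => Prod.fst ⁻¹' {x : H | ‖x‖ ^ 2 ≤ q}) (by
      refine Fin.cases (measurable_fst hA) fun _ => measurable_fst hB)
  rw [Fin.prod_univ_succ] at hprod
  simp only [Fin.cons_zero, Fin.cons_succ, hB1, Finset.prod_const_one, mul_one] at hprod
  rw [Measure.map_apply measurable_fst hA, ← hprod, Measure.map_apply measurable_genMat hS]
  refine measure_mono fun x hx l hl => ?_
  obtain ⟨hl1, hl2⟩ := Finset.mem_Ico.1 hl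
  obtain ⟨k, rfl⟩ : ∃ k, l = k + 1 := ⟨l - 1, by omega⟩
  have h0 : ‖(x 0).1‖ ^ 2 < q - ε := hx 0
  have h1 : ‖(x (k + 1)).1‖ ^ 2 ≤ q := hx (Fin.succ ⟨k, by omega⟩)
  have hle : ⟪(x 0).1, (x (k + 1)).1⟫ ≤ q - ε / 2 := by
    have := real_inner_le_norm (x 0).1 (x (k + 1)).1
    nlinarith [sq_nonneg (‖(x 0).1‖ - ‖(x (k + 1)).1‖)]
  simpa [genMat] using hle

/-- A sequence satisfying `n * a (n + 1) = (n - c) * a n` with `c > 0` has no positive lower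
bound, because the harmonic series diverges. -/
lemma nonpos_of_le_of_mul_succ_eq {a : ℕ → ℝ} {c L : ℝ} (hc : 0 < c)
    (ha : ∀ n, 2 ≤ n → n * a (n + 1) = (n - c) * a n) (hL : ∀ n, 2 ≤ n → L ≤ a n) : L ≤ 0 := by
  by_contra! hpos
  have hbound : ∀ n, 2 ≤ n → c * L * ∑ i ∈ Finset.range n, (1 / (i : ℝ)) ≤
      a 2 + c * L - a n := by
    intro n hn
    induction n, hn using Nat.le_induction with
    | base => simp [Finset.sum_range_succ]
    | succ n hn ih =>
      have hn0 : (0 : ℝ) < n := by exact_mod_cast (by omega : 0 < n)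
      have hstep : a (n + 1) = a n - c * a n * (1 / (n : ℝ)) := by
        have := ha n hn
        field_simp
        linarith
      have hdrop : c * L * (1 / (n : ℝ)) ≤ c * a n * (1 / (n : ℝ)) := by
        have := hL n hn
        gcongr
      rw [Finset.sum_range_succ, mul_add]
      linarith
  obtain ⟨N, hN⟩ := ((Real.tendsto_sum_range_one_div_nat_succ_atTop.const_mul_atTop
    (mul_pos hc hpos)).eventually_gt_atTop (a 2 + c * L)).exists_forall_of_atTop
  have h1 := hN (N + 2) (by omega)
  have h2 := hbound (N + 3) (by omega)
  have h3 := hL (N + 3) (by omega)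
  rw [Finset.sum_range_succ'] at h2
  push_cast at h1 h2
  simp only [div_zero, add_zero] at h2
  linarith

lemma abs_indicator_one_le {α : Type*} (S : Set α) (x : α) :
    |S.indicator (1 : α → ℝ) x| ≤ 1 := by
  by_cases hx : x ∈ S <;> simp [hx]

/-- The Ghirlanda–Guerra identities give a recursion for the probability that the first `n - 1`
overlaps of the first replica are at most `b`. -/
lemma SatisfiesGGI.measureReal_forall_le {Ω : Type*} [MeasurableSpace Ω] {P : Measure Ω}
    [IsProbabilityMeasure P] {R : Ω → Mat} (hGGI : SatisfiesGGI P R) (hR : Measurable R)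
    (b : ℝ) {n : ℕ} (hn : 2 ≤ n) :
    n * P.real {ω | ∀ l ∈ Finset.Ico 1 (n + 1), R ω 0 l ≤ b} =
      (n - P.real {ω | b < R ω 0 1}) * P.real {ω | ∀ l ∈ Finset.Ico 1 n, R ω 0 l ≤ b} := by
  set E : ℕ → Set Ω := fun n => {ω | ∀ l ∈ Finset.Ico 1 n, R ω 0 l ≤ b} with hE_def
  have hRm : ∀ i j, Measurable fun ω => R ω i j := fun i j => by fun_prop
  have hE : ∀ n, MeasurableSet (E n) := fun n => by
    refine MeasurableSet.congr (s := ⋂ l ∈ Finset.Ico 1 n, {ω | R ω 0 l ≤ b})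
      (Finset.measurableSet_biInter _ fun l _ => measurableSet_le (hRm 0 l) measurable_const) ?_
    ext ω; simp [hE_def]
  have hlast : ∀ l, MeasurableSet {ω | R ω 0 l ≤ b} := fun l =>
    measurableSet_le (hRm 0 l) measurable_const
  set S := {u : {p : Fin n × Fin n // p.1 < p.2} → ℝ |
      ∀ p, (p.1.1 : ℕ) = 0 → u p ≤ b} with hS_def
  have hS : MeasurableSet S := by
    simp only [hS_def, Set.ofPred_forall]
    exact MeasurableSet.iInter fun p => MeasurableSet.iInter fun _ =>
      measurableSet_le (measurable_pi_apply p) measurable_const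
  set f : ({p : Fin n × Fin n // p.1 < p.2} → ℝ) → ℝ := S.indicator 1 with hf_def
  set ψ := Set.indicator (Set.Iic b) (1 : ℝ → ℝ) with hψ_def
  have hf : ∀ ω, f (subU n (R ω)) = (E n).indicator 1 ω := by
    intro ω
    have : subU n (R ω) ∈ S ↔ ω ∈ E n := by
      simp only [hS_def, subU, Set.mem_ofPred_eq, hE_def, Finset.mem_Ico]
      constructor
      · intro h l hl
        exact h ⟨(⟨0, by omega⟩, ⟨l, hl.2⟩), Fin.mk_lt_mk.2 hl.1⟩ rfl
      · intro h p hp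
        have hlt := Fin.lt_def.1 p.2
        rw [hp]
        exact h _ ⟨by omega, p.1.2.2⟩
    by_cases hω : ω ∈ E n
    · rw [hf_def, Set.indicator_of_mem (this.2 hω), Set.indicator_of_mem hω]; rfl
    · rw [hf_def, Set.indicator_of_notMem (mt this.1 hω), Set.indicator_of_notMem hω]
  have hψ : ∀ ω l, ψ (R ω 0 l) = {ω | R ω 0 l ≤ b}.indicator 1 ω := fun ω l => by
    simp [hψ_def, Set.indicator_apply]
  have hmul : ∀ ω l, f (subU n (R ω)) * ψ (R ω 0 l) =
      (E n ∩ {ω | R ω 0 l ≤ b}).indicator 1 ω := fun ω l => by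
    rw [hf, hψ, Set.inter_indicator_one]; rfl
  have key := hGGI n hn f (measurable_one.indicator hS) ⟨1, abs_indicator_one_le _⟩ ψ
    (measurable_one.indicator measurableSet_Iic) ⟨1, abs_indicator_one_le _⟩
  simp only [hmul] at key
  simp only [hf, hψ, integral_indicator_one, hE, hlast, MeasurableSet.inter] at key
  have hsucc : E n ∩ {ω | R ω 0 n ≤ b} = E (n + 1) := by
    ext ω
    simp only [hE_def, Set.mem_inter_iff, Set.mem_ofPred_eq, Finset.mem_Ico]
    constructor
    · rintro ⟨h, hn'⟩ l hl
      rcases Nat.lt_succ_iff_lt_or_eq.1 hl.2 with h' | rfl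
      exacts [h l ⟨hl.1, h'⟩, hn']
    · exact fun h => ⟨fun l hl => h l ⟨hl.1, by omega⟩, h n ⟨by omega, by omega⟩⟩
  have hold : ∀ l ∈ Finset.Ico 1 n, P.real (E n ∩ {ω | R ω 0 l ≤ b}) = P.real (E n) := by
    intro l hl
    have hsub : E n ⊆ {ω | R ω 0 l ≤ b} := fun ω hω => hω l hl
    rw [Set.inter_eq_left.2 hsub]
  have hcompl : P.real {ω | R ω 0 1 ≤ b} = 1 - P.real {ω | b < R ω 0 1} := by
    rw [← probReal_compl_eq_one_sub (measurableSet_lt measurable_const (hRm 0 1))]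
    congr 1; ext ω; simp
  rw [hsucc, Finset.sum_congr rfl hold, hcompl, Finset.sum_const, Nat.card_Ico, nsmul_eq_mul,
    Nat.cast_sub (by omega)] at key
  have hn0 : (n : ℝ) ≠ 0 := by exact_mod_cast (by omega : n ≠ 0)
  rw [key]
  field_simp
  push_cast
  ring

/-- Theorem 2(a): if `q*` is the largest point of the support of `F` (the law of
`R_{1,2}`), then for almost all `ω` the directing measure `μ_ω` concentrates on
the sphere `{x : ‖x‖² = q*}`. -/
theorem directing_measure_on_sphere
    {Ω₁ Ω : Type*} [MeasurableSpace Ω₁] [MeasurableSpace Ω]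
    (P : Measure Ω₁) [IsProbabilityMeasure P] (Pr : Measure Ω) [IsProbabilityMeasure Pr]
    (R : Ω₁ → Mat) (hGdF : IsGramDeFinetti P R) (hGGI : SatisfiesGGI P R)
    (η : Kernel Ω (H × ℝ)) [IsMarkovKernel η]
    (hpos : ∀ ω, η ω {p | p.2 < 0} = 0)
    (ν : Kernel Ω (ℕ → H × ℝ)) [IsMarkovKernel ν]
    (hiid : ∀ ω, IsIIDFrom (ν ω) (η ω))
    (hrep : ∀ A : Set Mat, MeasurableSet A →
      Measure.map R P A = ∫⁻ ω, Measure.map genMat (ν ω) A ∂Pr)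
    (μ : Ω → Measure H) (hμ : ∀ ω, μ ω = (η ω).map Prod.fst)
    (F : Measure ℝ) (hF : F = Measure.map (fun ω₁ => R ω₁ 0 1) P)
    (qs : ℝ) (hqs_top : F (Set.Ioi qs) = 0)
    (hqs_supp : ∀ ε : ℝ, 0 < ε → 0 < F (Set.Ioo (qs - ε) (qs + ε))) :
    ∀ᵐ ω ∂Pr, μ ω {x | ‖x‖ ^ 2 = qs} = 1 := by
  have hR : Measurable R := hGdF.1
  have hR01 : Measurable fun ω₁ => R ω₁ 0 1 := by fun_prop
  have hmap : ∀ ω A, (ν.map genMat) ω A = (ν ω).map genMat A := fun ω A => by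
    rw [Kernel.map_apply _ measurable_genMat]
  have hmeas : ∀ A : Set Mat, MeasurableSet A → Measurable fun ω => (ν ω).map genMat A :=
    fun A hA => by simpa only [hmap] using Kernel.measurable_coe (ν.map genMat) hA
  have hnorm : Measurable fun x : H => ‖x‖ ^ 2 := by fun_prop
  have hlow : ∀ r : ℝ, MeasurableSet {x : H | ‖x‖ ^ 2 < r} := fun r =>
    measurableSet_lt hnorm measurable_const
  have hupper : ∀ᵐ ω ∂Pr, (η ω).map Prod.fst {x | qs < ‖x‖ ^ 2} = 0 := by
    have hA : MeasurableSet {M : Mat | qs < M 0 1} :=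
      measurableSet_lt measurable_const (by fun_prop)
    have h0 := hrep _ hA
    rw [hF, Measure.map_apply hR01 measurableSet_Ioi] at hqs_top
    rw [Measure.map_apply hR hA] at h0
    have h1 := (lintegral_eq_zero_iff (hmeas _ hA)).1 (h0.symm.trans hqs_top)
    filter_upwards [h1] with ω hω
    refine (hiid ω).ae_sq_norm_le ?_
    rw [Measure.map_apply measurable_genMat hA] at hω
    simpa [genMat] using hω
  have hlower : ∀ ε : ℝ, 0 < ε → ∀ᵐ ω ∂Pr, (η ω).map Prod.fst {x | ‖x‖ ^ 2 < qs - ε} = 0 := by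
    intro ε hε
    have hm : Measurable fun ω => (η ω).map Prod.fst {x | ‖x‖ ^ 2 < qs - ε} := by
      simp_rw [Measure.map_apply measurable_fst (hlow _)]
      exact Kernel.measurable_coe η (measurable_fst (hlow _))
    refine (lintegral_eq_zero_iff hm).1 ?_
    have hle : ∀ n, 2 ≤ n → ∫⁻ ω, (η ω).map Prod.fst {x | ‖x‖ ^ 2 < qs - ε} ∂Pr ≤
        P {ω | ∀ l ∈ Finset.Ico 1 n, R ω 0 l ≤ qs - ε / 2} := by
      intro n hn
      obtain ⟨k, rfl⟩ : ∃ k, n = k + 1 := ⟨n - 1, by omega⟩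
      have hS : MeasurableSet {M : Mat | ∀ l ∈ Finset.Ico 1 (k + 1), M 0 l ≤ qs - ε / 2} := by
        simp only [Set.ofPred_forall]
        exact MeasurableSet.iInter fun l => MeasurableSet.iInter fun _ =>
          measurableSet_le (by fun_prop) measurable_const
      calc _ ≤ ∫⁻ ω, (ν ω).map genMat
              {M : Mat | ∀ l ∈ Finset.Ico 1 (k + 1), M 0 l ≤ qs - ε / 2} ∂Pr :=
            lintegral_mono_ae <| hupper.mono fun ω hω => (hiid ω).measure_sq_norm_lt_le hω k
        _ = _ := by rw [← hrep _ hS, Measure.map_apply hR hS]; rfl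
    have hc : 0 < P.real {ω | qs - ε / 2 < R ω 0 1} := by
      have h := hqs_supp (ε / 2) (by linarith)
      rw [hF, Measure.map_apply hR01 measurableSet_Ioo] at h
      exact ENNReal.toReal_pos (h.trans_le (measure_mono fun ω hω => hω.1)).ne'
        (measure_ne_top _ _)
    have hfin : ∫⁻ ω, (η ω).map Prod.fst {x | ‖x‖ ^ 2 < qs - ε} ∂Pr ≠ ⊤ :=
      ((hle 2 le_rfl).trans_lt (measure_lt_top _ _)).ne
    have hzero := nonpos_of_le_of_mul_succ_eq hc
      (fun n hn => hGGI.measureReal_forall_le hR (qs - ε / 2) hn)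
      (fun n hn => ENNReal.toReal_mono (measure_ne_top _ _) (hle n hn))
    exact (ENNReal.toReal_eq_zero_iff _).1 (le_antisymm hzero ENNReal.toReal_nonneg)
      |>.resolve_right hfin
  have hlower' : ∀ᵐ ω ∂Pr, ∀ m : ℕ,
      (η ω).map Prod.fst {x | ‖x‖ ^ 2 < qs - 1 / ((m : ℝ) + 1)} = 0 :=
    ae_all_iff.2 fun m => hlower _ (by positivity)
  filter_upwards [hupper, hlower'] with ω h1 h2
  have : IsProbabilityMeasure ((η ω).map (Prod.fst : H × ℝ → H)) :=
    Measure.isProbabilityMeasure_map measurable_fst.aemeasurable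
  rw [hμ ω, ← prob_compl_eq_zero_iff (measurableSet_eq_fun hnorm measurable_const)]
  refine measure_mono_null (fun x hx => ?_) (measure_union_null h1 (measure_iUnion_null h2))
  rcases lt_or_gt_of_ne (show ‖x‖ ^ 2 ≠ qs from hx) with h | h
  · obtain ⟨m, hm⟩ := exists_nat_one_div_lt (sub_pos.2 h)
    exact Or.inr (Set.mem_iUnion.2 ⟨m, by simp only [Set.mem_ofPred_eq]; linarith⟩)
  · exact Or.inl h

end
end

section
/- Let q* be the largest point of the support of F and suppose F({q*}) = 0. Then for Pr-almost all ω the directing measure μ_ω is continuous, i.e. μ_ω has no atoms. -/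
open MeasureTheory ProbabilityTheory RealInnerProductSpace

noncomputable section

variable {H : Type*} [NormedAddCommGroup H] [InnerProductSpace ℝ H]
  [TopologicalSpace.SeparableSpace H] [MeasurableSpace H] [BorelSpace H]

/-- The event that the first `n` replicas have no overlap with the first one above `s`. -/
def overlapsLE {Ω : Type*} (R : Ω → Mat) (s : ℝ) (n : ℕ) : Set Ω :=
  {ω | ∀ l ∈ Finset.Ico 1 n, R ω 0 l ≤ s}

lemma measurable_entry_s7 {Ω : Type*} [MeasurableSpace Ω] {R : Ω → Mat} (hR : Measurable R)
    (i j : ℕ) : Measurable fun ω => R ω i j :=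
  (measurable_pi_apply j).comp ((measurable_pi_apply i).comp hR)

lemma measurableSet_overlapsLE {Ω : Type*} [MeasurableSpace Ω] {R : Ω → Mat} (hR : Measurable R)
    (s : ℝ) (n : ℕ) : MeasurableSet (overlapsLE R s n) := by
  have : overlapsLE R s n = ⋂ l ∈ Finset.Ico 1 n, {ω | R ω 0 l ≤ s} := by ext; simp [overlapsLE]
  rw [this]
  exact Finset.measurableSet_biInter _ fun l _ =>
    measurableSet_le (measurable_entry_s7 hR 0 l) measurable_const

lemma mem_overlapsLE_succ {Ω : Type*} {R : Ω → Mat} {s : ℝ} {n : ℕ} (hn : 1 ≤ n) {ω : Ω} :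
    ω ∈ overlapsLE R s (n + 1) ↔ ω ∈ overlapsLE R s n ∧ R ω 0 n ≤ s := by
  simp only [overlapsLE, Set.mem_ofPred_eq, Finset.mem_Ico]
  refine ⟨fun h => ⟨fun l hl => h l ⟨hl.1, by omega⟩, h n ⟨hn, by omega⟩⟩, fun h l hl => ?_⟩
  rcases (Nat.lt_succ_iff.mp hl.2).eq_or_lt with rfl | hlt
  · exact h.2
  · exact h.1 l ⟨hl.1, hlt⟩

/-- The set of strictly upper-triangular arrays whose first row is bounded by `s`. -/
def firstRowLE (s : ℝ) (n : ℕ) : Set ({p : Fin n × Fin n // p.1 < p.2} → ℝ) :=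
  {v | ∀ p, p.1.1.val = 0 → v p ≤ s}

lemma measurableSet_firstRowLE (s : ℝ) (n : ℕ) : MeasurableSet (firstRowLE s n) := by
  have : firstRowLE s n = ⋂ p : {p : Fin n × Fin n // p.1 < p.2}, ⋂ _ : p.1.1.val = 0,
      {v | v p ≤ s} := by
    ext; simp [firstRowLE]
  rw [this]
  exact MeasurableSet.iInter fun p => MeasurableSet.iInter fun _ =>
    measurableSet_le (measurable_pi_apply p) measurable_const

lemma subU_mem_firstRowLE {Ω : Type*} {R : Ω → Mat} {s : ℝ} {n : ℕ} {ω : Ω} :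
    subU n (R ω) ∈ firstRowLE s n ↔ ω ∈ overlapsLE R s n := by
  constructor
  · intro h l hl
    rw [Finset.mem_Ico] at hl
    exact h ⟨(⟨0, by omega⟩, ⟨l, hl.2⟩), Fin.mk_lt_mk.mpr (by omega)⟩ rfl
  · rintro h ⟨⟨i, j⟩, hij⟩ hi
    have hi' : (i : ℕ) = 0 := hi
    have hij' : (i : ℕ) < j := hij
    have := h j (Finset.mem_Ico.mpr ⟨by omega, j.2⟩)
    rwa [← hi'] at this

lemma abs_indicator_one_le_s7 {α : Type*} (T : Set α) :
    ∃ C, ∀ x, |T.indicator (fun _ => (1 : ℝ)) x| ≤ C :=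
  ⟨1, fun x => by by_cases h : x ∈ T <;> simp [h]⟩

/-- The Ghirlanda–Guerra identities give the conditional probability that the next overlap is the
first one above `s`. -/
lemma SatisfiesGGI.measureReal_overlapsLE_sub {Ω : Type*} [MeasurableSpace Ω] {P : Measure Ω}
    [IsProbabilityMeasure P] {R : Ω → Mat} (hR : Measurable R) (hGGI : SatisfiesGGI P R) (s : ℝ)
    {n : ℕ} (hn : 2 ≤ n) :
    P.real (overlapsLE R s n) - P.real (overlapsLE R s (n + 1)) =
      1 / n * P.real (overlapsLE R s n) * P.real {ω | s < R ω 0 1} := by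
  have hE := measurableSet_overlapsLE hR s
  have key := hGGI n hn ((firstRowLE s n).indicator fun _ => 1)
    (measurable_const.indicator (measurableSet_firstRowLE s n)) (abs_indicator_one_le_s7 _)
    ((Set.Ioi s).indicator fun _ => 1) (measurable_const.indicator measurableSet_Ioi)
    (abs_indicator_one_le_s7 _)
  have hf : ∀ ω, (firstRowLE s n).indicator (fun _ => (1 : ℝ)) (subU n (R ω)) =
      (overlapsLE R s n).indicator (fun _ => 1) ω := fun ω => by
    by_cases h : ω ∈ overlapsLE R s n
    · rw [Set.indicator_of_mem h, Set.indicator_of_mem (subU_mem_firstRowLE.mpr h)]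
    · rw [Set.indicator_of_notMem h, Set.indicator_of_notMem (mt subU_mem_firstRowLE.mp h)]
  have hψ : ∀ ω, (Set.Ioi s).indicator (fun _ => (1 : ℝ)) (R ω 0 1) =
      {ω | s < R ω 0 1}.indicator (fun _ => 1) ω := fun ω => rfl
  have hnew : ∀ ω, (overlapsLE R s n).indicator (fun _ => (1 : ℝ)) ω *
      (Set.Ioi s).indicator (fun _ => 1) (R ω 0 n) =
      (overlapsLE R s n \ overlapsLE R s (n + 1)).indicator (fun _ => 1) ω := fun ω => by
    have hsucc := mem_overlapsLE_succ (R := R) (s := s) (ω := ω) (show 1 ≤ n by omega)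
    by_cases h : ω ∈ overlapsLE R s n <;> by_cases h' : s < R ω 0 n <;>
      simp [Set.indicator, hsucc, h, h']
  have hold : ∑ l ∈ Finset.Ico 1 n, ∫ ω, (overlapsLE R s n).indicator (fun _ => (1 : ℝ)) ω *
      (Set.Ioi s).indicator (fun _ => 1) (R ω 0 l) ∂P = 0 := by
    refine Finset.sum_eq_zero fun l hl => integral_eq_zero_of_ae (ae_of_all _ fun ω => ?_)
    by_cases h : ω ∈ overlapsLE R s n
    · have : R ω 0 l ∉ Set.Ioi s := not_lt.mpr (h l hl)
      simp [Set.indicator_of_notMem this]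
    · simp [h]
  simp_rw [hf, hnew, hψ] at key
  rw [hold, integral_indicator_const _ ((hE n).diff (hE (n + 1))),
    integral_indicator_const _ (hE n),
    integral_indicator_const _ (measurableSet_lt measurable_const (measurable_entry_s7 hR 0 1)),
    measureReal_sdiff (fun ω h => ((mem_overlapsLE_succ (by omega)).mp h).1) (hE (n + 1))] at key
  simpa only [smul_eq_mul, mul_one, mul_zero, add_zero] using key

/-- Under the Ghirlanda–Guerra identities, almost surely the first replica has an overlap above
any level that the law of one overlap charges. -/
lemma SatisfiesGGI.measure_forall_le_eq_zero {Ω : Type*} [MeasurableSpace Ω] {P : Measure Ω}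
    [IsProbabilityMeasure P] {R : Ω → Mat} (hR : Measurable R) (hGGI : SatisfiesGGI P R) {s : ℝ}
    (hs : P {ω | s < R ω 0 1} ≠ 0) : P {ω | ∀ l, R ω 0 (l + 1) ≤ s} = 0 := by
  set b := P.real {ω | s < R ω 0 1}
  have hbpos : 0 < b := ENNReal.toReal_pos hs (measure_ne_top _ _)
  by_contra hne
  set a := P.real {ω | ∀ l, R ω 0 (l + 1) ≤ s}
  have hapos : 0 < a := ENNReal.toReal_pos hne (measure_ne_top _ _)
  have hale : ∀ n, a ≤ P.real (overlapsLE R s n) := fun n => measureReal_mono fun ω h l hl => by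
    rw [Finset.mem_Ico] at hl
    have := h (l - 1)
    rwa [Nat.sub_add_cancel hl.1] at this
  have hsum : ∀ N, ∑ i ∈ Finset.range N, a * b * (1 / ((i + 2 : ℕ) : ℝ)) ≤
      P.real (overlapsLE R s 2) - P.real (overlapsLE R s (N + 2)) := by
    intro N
    induction N with
    | zero => simp
    | succ N ih =>
      rw [Finset.sum_range_succ]
      have h1 := hGGI.measureReal_overlapsLE_sub hR s (show 2 ≤ N + 2 by omega)
      have h2 : a * b * (1 / ((N + 2 : ℕ) : ℝ)) ≤
          1 / ((N + 2 : ℕ) : ℝ) * P.real (overlapsLE R s (N + 2)) * b := by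
        have := mul_le_mul_of_nonneg_left (hale (N + 2))
          (show 0 ≤ b * (1 / ((N + 2 : ℕ) : ℝ)) by positivity)
        linarith
      rw [show N + 1 + 2 = N + 2 + 1 by ring]
      linarith
  have hsummable : Summable fun i : ℕ => a * b * (1 / ((i + 2 : ℕ) : ℝ)) :=
    summable_of_sum_range_le (c := P.real (overlapsLE R s 2)) (fun i => by positivity) fun N =>
      (hsum N).trans (sub_le_self _ measureReal_nonneg)
  rw [summable_mul_left_iff (mul_pos hapos hbpos).ne'] at hsummable
  exact Real.not_summable_one_div_natCast
    ((summable_nat_add_iff (f := fun n : ℕ => 1 / (n : ℝ)) 2).mp hsummable)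

/-- In a separable inner product space, if the inner product of two independent samples from `μ`
is almost surely less than `q`, then the squared norm of a sample is almost surely at most `q`. -/
lemma measure_lt_inner_self_eq_zero {μ : Measure H} {q : ℝ}
    (hμ : ∀ V, MeasurableSet V → (∀ x ∈ V, ∀ y ∈ V, q ≤ ⟪x, y⟫) → μ V = 0) :
    μ {x | q < ⟪x, x⟫} = 0 := by
  have : SecondCountableTopology H := UniformSpace.secondCountable_of_separable H
  by_contra hne
  obtain ⟨x, hx, hpos⟩ := exists_mem_forall_mem_nhdsWithin_pos_measure hne
  have hnhds : ∀ᶠ p : H × H in nhds (x, x), q < ⟪p.1, p.2⟫ :=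
    (continuous_fst.inner continuous_snd).continuousAt.eventually_const_lt hx
  rw [nhds_prod_eq] at hnhds
  obtain ⟨t, ht, hqt⟩ := Filter.mem_prod_same_iff.mp hnhds
  have htp := hpos (interior t)
    (mem_nhdsWithin_of_mem_nhds (isOpen_interior.mem_nhds (mem_interior_iff_mem_nhds.mpr ht)))
  exact htp.ne' (hμ _ isOpen_interior.measurableSet fun x hx y hy =>
    le_of_lt (@hqt (x, y) ⟨interior_subset hx, interior_subset hy⟩))

/-- If the squared norm is almost everywhere at most `q`, then a point of squared norm less than
`q` has inner product bounded away from `q` with almost every point. -/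
lemma exists_measure_lt_inner_eq_zero {E : Type*} [NormedAddCommGroup E]
    [InnerProductSpace ℝ E] [MeasurableSpace E] {μ : Measure E} {q : ℝ} (hμ : μ {y | q < ⟪y, y⟫} = 0)
    {x : E} (hx : ⟪x, x⟫ < q) : ∃ k : ℕ, μ {y | q - 1 / (k + 1) < ⟪x, y⟫} = 0 := by
  rw [real_inner_self_eq_norm_sq] at hx
  have hq : 0 < q := (sq_nonneg _).trans_lt hx
  have hlt : ‖x‖ * √q < q := calc
    ‖x‖ * √q < √q * √q :=
      mul_lt_mul_of_pos_right (Real.lt_sqrt_of_sq_lt hx) (Real.sqrt_pos.mpr hq)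
    _ = q := Real.mul_self_sqrt hq.le
  obtain ⟨k, hk⟩ := exists_nat_one_div_lt (sub_pos.mpr hlt)
  refine ⟨k, measure_mono_null (fun y hy => ?_) hμ⟩
  have hy' : q - 1 / (k + 1) < ⟪x, y⟫ := hy
  have hxy := real_inner_le_norm x y
  have hlt' : √q < ‖y‖ := lt_of_mul_lt_mul_left (by linarith) (norm_nonneg x)
  show q < ⟪y, y⟫
  rw [real_inner_self_eq_norm_sq]
  exact (Real.sqrt_lt' ((Real.sqrt_nonneg q).trans_lt hlt')).mp hlt'

lemma genMat_of_ne {E : Type*} [NormedAddCommGroup E] [InnerProductSpace ℝ E] (x : ℕ → E × ℝ)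
    {i j : ℕ} (h : i ≠ j) : genMat x i j = ⟪(x i).1, (x j).1⟫ := by
  simp [genMat, h]

lemma IsIIDFrom.measure_coord {E : Type*} [MeasurableSpace E]
    {ν : Measure (ℕ → E × ℝ)} {η : Measure (E × ℝ)} [IsProbabilityMeasure η]
    (h : IsIIDFrom ν η) (l : ℕ) {A : Set (E × ℝ)} (hA : MeasurableSet A) : ν {x | x l ∈ A} = η A := by
  have := h (l + 1) (fun i => if i = Fin.last l then A else Set.univ) fun i => by
    split_ifs <;> simp [hA]
  rw [Finset.prod_eq_single (Fin.last l) (fun i _ hi => by simp [hi]) (by simp), if_pos rfl] at this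
  rw [← this]
  congr 1
  ext x
  refine ⟨fun hx i => ?_, fun hx => by simpa using hx (Fin.last l)⟩
  split_ifs with hi
  · simpa [hi] using hx
  · trivial

lemma IsIIDFrom.measure_pair {E : Type*} [MeasurableSpace E]
    {ν : Measure (ℕ → E × ℝ)} {η : Measure (E × ℝ)}
    (h : IsIIDFrom ν η) {A : Set (E × ℝ)} (hA : MeasurableSet A) :
    ν {x | x 0 ∈ A ∧ x 1 ∈ A} = η A * η A := by
  simpa [Fin.forall_fin_two, Fin.prod_univ_two, ← sq] using h 2 (fun _ => A) fun _ => hA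

/-- An almost sure property of the Gram matrix holds almost surely for almost every directing
measure. -/
lemma ae_measure_genMat_eq_zero {Ω₁ Ω : Type*} [MeasurableSpace Ω₁] [MeasurableSpace Ω]
    {P : Measure Ω₁} {Pr : Measure Ω} {R : Ω₁ → Mat} (hR : Measurable R)
    {ν : Kernel Ω (ℕ → H × ℝ)}
    (hrep : ∀ A : Set Mat, MeasurableSet A →
      Measure.map R P A = ∫⁻ ω, Measure.map genMat (ν ω) A ∂Pr)
    {A : Set Mat} (hA : MeasurableSet A) (h : P (R ⁻¹' A) = 0) :
    ∀ᵐ ω ∂Pr, ν ω (genMat ⁻¹' A) = 0 := by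
  have h0 := hrep A hA
  simp_rw [Measure.map_apply hR hA, Measure.map_apply measurable_genMat hA, h] at h0
  exact (lintegral_eq_zero_iff (ν.measurable_coe (measurable_genMat hA))).mp h0.symm

/-- Theorem 2(b): if `q*` is the largest point of the support of `F` (the law of
`R_{1,2}`) and `F({q*}) = 0`, then for almost all `ω` the directing measure
`μ_ω` is continuous (has no atoms). -/
theorem directing_measure_continuous
    {Ω₁ Ω : Type*} [MeasurableSpace Ω₁] [MeasurableSpace Ω]
    (P : Measure Ω₁) [IsProbabilityMeasure P] (Pr : Measure Ω) [IsProbabilityMeasure Pr]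
    (R : Ω₁ → Mat) (hGdF : IsGramDeFinetti P R) (hGGI : SatisfiesGGI P R)
    (η : Kernel Ω (H × ℝ)) [IsMarkovKernel η]
    (hpos : ∀ ω, η ω {p | p.2 < 0} = 0)
    (ν : Kernel Ω (ℕ → H × ℝ)) [IsMarkovKernel ν]
    (hiid : ∀ ω, IsIIDFrom (ν ω) (η ω))
    (hrep : ∀ A : Set Mat, MeasurableSet A →
      Measure.map R P A = ∫⁻ ω, Measure.map genMat (ν ω) A ∂Pr)
    (μ : Ω → Measure H) (hμ : ∀ ω, μ ω = (η ω).map Prod.fst)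
    (F : Measure ℝ) (hF : F = Measure.map (fun ω₁ => R ω₁ 0 1) P)
    (qs : ℝ) (hqs_top : F (Set.Ioi qs) = 0)
    (hqs_supp : ∀ ε : ℝ, 0 < ε → 0 < F (Set.Ioo (qs - ε) (qs + ε)))
    (hatom : F {qs} = 0) :
    ∀ᵐ ω ∂Pr, ∀ x : H, μ ω {x} = 0 := by
  have hR := hGdF.1
  have : SecondCountableTopology H := UniformSpace.secondCountable_of_separable H
  have hMm : ∀ i j, Measurable fun M : Mat => M i j := measurable_entry_s7 measurable_id
  have hRm : Measurable fun ω => R ω 0 1 := (hMm 0 1).comp hR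
  subst hF
  have htop : P (R ⁻¹' {M | qs ≤ M 0 1}) = 0 := by
    have h := measure_union_null hatom hqs_top
    rwa [Set.singleton_union, Set.Ioi_insert, Measure.map_apply hRm measurableSet_Ici] at h
  have hlevel : ∀ k : ℕ, P (R ⁻¹' {M | ∀ l, M 0 (l + 1) ≤ qs - 1 / (k + 1)}) = 0 := by
    intro k
    refine hGGI.measure_forall_le_eq_zero hR fun h0 => ?_
    have h := hqs_supp (1 / (k + 1)) (by positivity)
    rw [Measure.map_apply hRm measurableSet_Ioo] at h
    exact h.ne' (measure_mono_null (fun ω hω => hω.1) h0)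
  have hlevel_meas : ∀ s : ℝ, MeasurableSet {M : Mat | ∀ l, M 0 (l + 1) ≤ s} := fun s => by
    rw [Set.ofPred_forall]
    exact MeasurableSet.iInter fun l => measurableSet_le (hMm 0 (l + 1)) measurable_const
  filter_upwards [ae_measure_genMat_eq_zero hR hrep
      (measurableSet_le measurable_const (hMm 0 1)) htop,
    ae_all_iff.mpr fun k => ae_measure_genMat_eq_zero hR hrep (hlevel_meas _) (hlevel k)]
    with ω hω_top hω_level x
  have hμ_apply : ∀ V, MeasurableSet V → μ ω V = η ω (Prod.fst ⁻¹' V) := fun V hV => by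
    rw [hμ, Measure.map_apply measurable_fst hV]
  have hnull : ∀ V, MeasurableSet V → (∀ y ∈ V, ∀ z ∈ V, qs ≤ ⟪y, z⟫) → μ ω V = 0 := by
    intro V hV hqV
    rw [hμ_apply V hV, ← mul_self_eq_zero, ← (hiid ω).measure_pair (measurable_fst hV)]
    refine measure_mono_null (fun y hy => ?_) hω_top
    show qs ≤ genMat y 0 1
    rw [genMat_of_ne y zero_ne_one]
    exact hqV _ hy.1 _ hy.2
  by_contra hx
  have hxq : ⟪x, x⟫ < qs := by
    by_contra! hle
    exact hx (hnull {x} (measurableSet_singleton x) (by simpa using hle))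
  obtain ⟨k, hk⟩ := exists_measure_lt_inner_eq_zero (measure_lt_inner_self_eq_zero hnull) hxq
  set V : Set H := {y | qs - 1 / (k + 1) < ⟪x, y⟫} with hV
  have hVm : MeasurableSet V :=
    measurableSet_lt measurable_const (measurable_const.inner measurable_id)
  rw [hμ_apply V hVm] at hk
  rw [hμ_apply _ (measurableSet_singleton x),
    ← (hiid ω).measure_coord 0 (measurable_fst (measurableSet_singleton x))] at hx
  refine hx (measure_mono_null (fun y hy => ?_) (measure_union_null (hω_level k)
    (measure_iUnion_null fun l => ((hiid ω).measure_coord (l + 1) (measurable_fst hVm)).trans hk)))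
  by_cases h : ∀ l, genMat y 0 (l + 1) ≤ qs - 1 / (k + 1)
  · exact Or.inl h
  · push Not at h
    obtain ⟨l, hl⟩ := h
    rw [genMat_of_ne y (Nat.succ_ne_zero l).symm, show (y 0).1 = x from hy] at hl
    exact Or.inr (Set.mem_iUnion.mpr ⟨l, hl⟩)

end
end

section
/- Set s = 1 − F({q*}), and for m ≥ 1 and integers n₁,…,n_m ≥ 1 define S(n₁,…,n_m) = E[ ∏_{j=1}^{m} Σ_{l≥1} w_l(ω)^{n_j} ], the expectation taken under Pr. Then with n = n₁ + ⋯ + n_m, S(n₁+1, n₂, …, n_m) = ((n₁ − s)/n) S(n₁, …, n_m) + Σ_{p=2}^{m} (n_p/n) S(n₁+n_p, n₂, …, n_{p−1}, n_{p+1}, …, n_m). -/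
open MeasureTheory ProbabilityTheory RealInnerProductSpace

noncomputable section

variable {H : Type*} [NormedAddCommGroup H] [InnerProductSpace ℝ H]
  [TopologicalSpace.SeparableSpace H] [MeasurableSpace H] [BorelSpace H]

/-- Product of sums over `ℕ`, expanded as a sum over multi-indices. -/
lemma prod_tsum_coe_nnreal {ι : Type*} [Fintype ι] (f : ι → ℕ → NNReal) :
    ∏ i, ∑' l, (f i l : ENNReal) = ∑' a : ι → ℕ, ∏ i, (f i (a i) : ENNReal) := by
  let ρ : ι → Measure ℕ := fun i => Measure.count.withDensity fun l => (f i l : ENNReal)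
  have hρ : ∀ i l, ρ i {l} = f i l := fun i l => by
    simp [ρ, withDensity_apply]
  have hρ_univ : ∀ i, ρ i Set.univ = ∑' l, (f i l : ENNReal) := fun i => by
    simp [ρ, withDensity_apply, lintegral_count]
  have htsum := Measure.tsum_indicator_apply_singleton (Measure.pi ρ) Set.univ MeasurableSet.univ
  simp only [Set.indicator_univ, Measure.pi_singleton, hρ, Measure.pi_univ, hρ_univ] at htsum
  exact htsum.symm

/-- The coloring of `{0, …, L.sum - 1}` by consecutive blocks whose sizes are listed in `L`. -/
def blockIndex : List ℕ → ℕ → ℕ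
  | [], _ => 0
  | a :: L, i => if i < a then 0 else blockIndex L (i - a) + 1

lemma blockIndex_lt (L : List ℕ) (i : ℕ) (hi : i < L.sum) : blockIndex L i < L.length := by
  induction L generalizing i with
  | nil => simp at hi
  | cons a L ih =>
    rw [List.sum_cons] at hi
    simp only [blockIndex, List.length_cons]
    split_ifs with h
    · omega
    · have := ih (i - a) (by omega)
      omega

lemma count_blockIndex (L : List ℕ) (k : ℕ) (hk : k < L.length) :
    Nat.count (fun i => blockIndex L i = k) L.sum = L.getD k 0 := by
  induction L generalizing k with
  | nil => simp at hk
  | cons a L ih =>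
    rw [List.sum_cons, Nat.count_add]
    have hfirst : Nat.count (fun i => blockIndex (a :: L) i = k) a = if k = 0 then a else 0 := by
      rw [Nat.count_eq_card_filter_range]
      split_ifs with h
      · rw [Finset.filter_true_of_mem, Finset.card_range]
        intro i hi
        simp [blockIndex, Finset.mem_range.1 hi, h]
      · rw [Finset.card_eq_zero, Finset.filter_eq_empty_iff]
        intro i hi
        simp [blockIndex, Finset.mem_range.1 hi, Ne.symm h]
    rw [hfirst]
    cases k with
    | zero => simp [blockIndex]
    | succ k =>
      have hk' : k < L.length := by simpa using hk
      simpa [blockIndex] using ih k hk'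

lemma sum_blockIndex (L : List ℕ) (u : ℕ → ℝ) :
    ∑ i ∈ Finset.range L.sum, u (blockIndex L i)
      = ∑ k ∈ Finset.range L.length, (L.getD k 0 : ℝ) * u k := by
  induction L generalizing u with
  | nil => simp
  | cons a L ih =>
    rw [List.sum_cons, Finset.sum_range_add, List.length_cons, Finset.sum_range_succ', add_comm]
    congr 1
    · simpa [blockIndex] using ih fun k => u (k + 1)
    · rw [Finset.sum_congr rfl (g := fun _ => u 0)]
      · simp
      · intro i hi
        simp [blockIndex, Finset.mem_range.1 hi]

/-- Counting a color after recoloring `b` as `0`. -/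
lemma count_merge (c : ℕ → ℕ) (b : ℕ) (hb : b ≠ 0) (n k : ℕ) :
    Nat.count (fun i => (if c i = b then 0 else c i) = k) n
      = if k = 0 then Nat.count (fun i => c i = 0) n + Nat.count (fun i => c i = b) n
        else if k = b then 0 else Nat.count (fun i => c i = k) n := by
  induction n with
  | zero => simp
  | succ n ih =>
    simp only [Nat.count_succ, ih]
    split_ifs <;> omega

/-- Counting a color after giving color `0` to the additional point `n`. -/
lemma count_extend (c : ℕ → ℕ) (n k : ℕ) :
    Nat.count (fun i => (if i = n then 0 else c i) = k) (n + 1)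
      = Nat.count (fun i => c i = k) n + if k = 0 then 1 else 0 := by
  rw [Nat.count_succ, Nat.count_eq_card_filter_range, Nat.count_eq_card_filter_range]
  congr 1
  · congr 1
    refine Finset.filter_congr fun i hi => ?_
    rw [if_neg (Finset.mem_range.1 hi).ne]
  · simp [eq_comm]

lemma prod_range_getD {M : Type*} [CommMonoid M] (L : List ℕ) (g : ℕ → M) :
    ∏ k ∈ Finset.range L.length, g (L.getD k 0) = (L.map g).prod := by
  induction L with
  | nil => simp
  | cons a L ih =>
    rw [List.length_cons, Finset.prod_range_succ', List.map_cons, List.prod_cons, mul_comm]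
    simpa using congrArg (g a * ·) ih

lemma prod_range_getD_eraseIdx {M : Type*} [CommMonoid M] (L : List ℕ) (g : ℕ → M) (hg : g 0 = 1)
    (p : ℕ) (hp : p < L.length) :
    ∏ k ∈ Finset.range L.length, g (if k = p then 0 else L.getD k 0)
      = ((L.eraseIdx p).map g).prod := by
  induction L generalizing p with
  | nil => simp at hp
  | cons a L ih =>
    rw [List.length_cons, Finset.prod_range_succ', mul_comm]
    cases p with
    | zero => simpa [hg] using prod_range_getD L g
    | succ p =>
      have hp' : p < L.length := by simpa using hp
      simpa using congrArg (g a * ·) (ih p hp')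

/-- The power sum `∑ v_l ^ k` in `[0, ∞]`, normalised to be `1` for `k = 0`. -/
def powerSum (v : ℕ → ℝ) (k : ℕ) : ENNReal :=
  if k = 0 then 1 else ∑' l, ENNReal.ofReal (v l) ^ k

@[simp] lemma powerSum_zero (v : ℕ → ℝ) : powerSum v 0 = 1 := if_pos rfl

lemma measurable_powerSum (k : ℕ) : Measurable fun v : ℕ → ℝ => powerSum v k := by
  unfold powerSum
  split_ifs
  · exact measurable_const
  · exact Measurable.tsum fun l => (measurable_pi_apply l).ennreal_ofReal.pow_const k

lemma powerSum_le_one (v : ℕ → ℝ) (hv1 : ∑' l, ENNReal.ofReal (v l) = 1) (k : ℕ) :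
    powerSum v k ≤ 1 := by
  unfold powerSum
  split_ifs with hk
  · exact le_rfl
  · rw [← hv1]
    refine ENNReal.tsum_le_tsum fun l => ?_
    have hl : ENNReal.ofReal (v l) ≤ 1 := hv1 ▸ ENNReal.le_tsum l
    simpa using pow_le_pow_of_le_one zero_le hl (Nat.one_le_iff_ne_zero.2 hk)

lemma toReal_powerSum (v : ℕ → ℝ) (hv : ∀ l, 0 ≤ v l) (k : ℕ) (hk : 1 ≤ k) :
    (powerSum v k).toReal = ∑' l, v l ^ k := by
  have hne : ∀ l, ENNReal.ofReal (v l) ^ k ≠ ⊤ := fun l => ENNReal.pow_ne_top ENNReal.ofReal_ne_top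
  rw [powerSum, if_neg (by omega), ENNReal.tsum_toReal_eq hne]
  simp [ENNReal.toReal_ofReal (hv _)]

lemma prod_le_one_of_forall_le_one (L : List ENNReal) (h : ∀ x ∈ L, x ≤ 1) : L.prod ≤ 1 := by
  induction L with
  | nil => simp
  | cons a L ih =>
    rw [List.prod_cons]
    exact mul_le_one' (h a (by simp)) (ih fun x hx => h x (by simp [hx]))

/-- Real moments of the weights as `[0, ∞]`-valued integrals. -/
lemma integral_prod_tsum_pow {Ω : Type*} [MeasurableSpace Ω] (Pr : Measure Ω)
    (w : Ω → ℕ → ℝ) (hw_meas : Measurable w)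
    (hw : ∀ᵐ ω ∂Pr, (∀ l, 0 ≤ w ω l) ∧ ∑' l, ENNReal.ofReal (w ω l) = 1)
    (L : List ℕ) (hL : ∀ k ∈ L, 1 ≤ k) :
    ∫ ω, (L.map fun k => ∑' l, w ω l ^ k).prod ∂Pr
      = (∫⁻ ω, (L.map (powerSum (w ω))).prod ∂Pr).toReal := by
  have hmeas : Measurable fun ω => (L.map (powerSum (w ω))).prod := by
    clear hL
    induction L with
    | nil => simp
    | cons a L ih =>
      simp only [List.map_cons, List.prod_cons]
      exact ((measurable_powerSum a).comp hw_meas).mul ih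
  rw [← integral_toReal hmeas.aemeasurable]
  · refine integral_congr_ae ?_
    filter_upwards [hw] with ω hω
    refine Eq.trans ?_ (map_list_prod ENNReal.toRealHom _).symm
    rw [List.map_map]
    congr 1
    refine List.map_congr_left fun k hk => ?_
    exact (toReal_powerSum _ hω.1 k (hL k hk)).symm
  · filter_upwards [hw] with ω hω
    refine (prod_le_one_of_forall_le_one _ fun x hx => ?_).trans_lt ENNReal.one_lt_top
    obtain ⟨k, -, rfl⟩ := List.mem_map.1 hx
    exact powerSum_le_one _ hω.2 k

lemma measurableSet_forall_entry_eq (r : ℕ → ℕ → Prop) (q : ℝ) :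
    MeasurableSet {M : Mat | ∀ i j, r i j → M i j = q} := by
  have : {M : Mat | ∀ i j, r i j → M i j = q} = ⋂ i, ⋂ j, ⋂ _ : r i j, {M | M i j = q} := by
    ext M
    simp
  rw [this]
  refine MeasurableSet.iInter fun i => MeasurableSet.iInter fun j => MeasurableSet.iInter fun _ => ?_
  exact measurableSet_eq_fun ((measurable_pi_apply j).comp (measurable_pi_apply i))
    measurable_const

/-- For two points of a sphere, the inner product is the squared radius only if they coincide. -/
lemma inner_eq_iff_eq_of_norm_sq_eq {E : Type*} [NormedAddCommGroup E] [InnerProductSpace ℝ E]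
    {x y : E} {q : ℝ} (hx : ‖x‖ ^ 2 = q) (hy : ‖y‖ ^ 2 = q) : ⟪x, y⟫ = q ↔ x = y := by
  constructor
  · intro h
    have hsub : ‖x - y‖ ^ 2 = 0 := by
      rw [norm_sub_sq_real, h, hx, hy]
      ring
    exact sub_eq_zero.1 (norm_eq_zero.1 (pow_eq_zero_iff two_ne_zero |>.1 hsub))
  · rintro rfl
    rw [real_inner_self_eq_norm_sq, hx]

/-- The relation `r` holds only between pairs `i < j < n` of the same color, and generates the
relation of having the same color on `{0, …, n - 1}`. -/
structure Generates (r : ℕ → ℕ → Prop) (c : ℕ → ℕ) (n : ℕ) : Prop where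
  lt : ∀ i j, r i j → i < j ∧ j < n
  color_eq : ∀ i j, r i j → c i = c j
  eqvGen : ∀ i j, i < n → j < n → c i = c j → Relation.EqvGen r i j

lemma Generates.forall_eq_iff {r : ℕ → ℕ → Prop} {c : ℕ → ℕ} {n : ℕ} (hr : Generates r c n)
    {E : Type*} (x : ℕ → E) :
    (∀ i j, r i j → x i = x j) ↔ ∀ i j, i < n → j < n → c i = c j → x i = x j := by
  constructor
  · intro h i j hi hj hij
    have hgen := hr.eqvGen i j hi hj hij
    clear hi hj hij
    induction hgen with
    | rel i j hij => exact h i j hij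
    | refl i => rfl
    | symm i j _ ih => exact ih.symm
    | trans i j k _ _ ih₁ ih₂ => exact ih₁.trans ih₂
  · intro h i j hij
    obtain ⟨hlt, hjn⟩ := hr.lt i j hij
    exact h i j (hlt.trans hjn) hjn (hr.color_eq i j hij)

/-- Pairs `i < j < n` of the same color. -/
def sameColor (c : ℕ → ℕ) (n i j : ℕ) : Prop := i < j ∧ j < n ∧ c i = c j

/-- The relation `r` together with the pair `(0, l)`. -/
def addEdge (r : ℕ → ℕ → Prop) (l i j : ℕ) : Prop := r i j ∨ (i = 0 ∧ j = l)

lemma generates_sameColor (c : ℕ → ℕ) (n : ℕ) : Generates (sameColor c n) c n where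
  lt _ _ h := ⟨h.1, h.2.1⟩
  color_eq _ _ h := h.2.2
  eqvGen i j hi hj hij := by
    rcases lt_trichotomy i j with h | rfl | h
    · exact .rel _ _ ⟨h, hj, hij⟩
    · exact .refl _
    · exact .symm _ _ (.rel _ _ ⟨h, hi, hij.symm⟩)

lemma eqvGen_addEdge_sameColor (c : ℕ → ℕ) (n l : ℕ) {i j : ℕ} (hi : i < n) (hj : j < n)
    (hij : c i = c j) : Relation.EqvGen (addEdge (sameColor c n) l) i j :=
  ((generates_sameColor c n).eqvGen i j hi hj hij).mono fun _ _ => Or.inl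

lemma generates_extend (c : ℕ → ℕ) (n : ℕ) (hn : 0 < n) (hc : c 0 = 0) :
    Generates (addEdge (sameColor c n) n) (fun i => if i = n then 0 else c i) (n + 1) where
  lt i j h := by
    rcases h with ⟨h1, h2, -⟩ | ⟨rfl, rfl⟩ <;> omega
  color_eq i j h := by
    rcases h with ⟨h1, h2, h3⟩ | ⟨rfl, rfl⟩
    · simp [h2.ne, (h1.trans h2).ne, h3]
    · simp [hn.ne, hc]
  eqvGen i j hi hj hij := by
    have hedge : Relation.EqvGen (addEdge (sameColor c n) n) 0 n := .rel _ _ (Or.inr ⟨rfl, rfl⟩)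
    have hbase := fun {i j : ℕ} => eqvGen_addEdge_sameColor c n n (i := i) (j := j)
    split_ifs at hij with h1 h2 h2
    · rw [h1, h2]
      exact .refl _
    · rw [h1]
      exact .trans _ _ _ (.symm _ _ hedge) (hbase hn (by omega) (hc.trans hij))
    · rw [h2]
      exact .trans _ _ _ (hbase (by omega) hn (hij.trans hc.symm)) hedge
    · exact hbase (by omega) (by omega) hij

lemma generates_merge (c : ℕ → ℕ) (n l : ℕ) (hc : c 0 = 0) (hl : 0 < l) (hln : l < n) :
    Generates (addEdge (sameColor c n) l) (fun i => if c i = c l then 0 else c i) n where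
  lt i j h := by
    rcases h with ⟨h1, h2, -⟩ | ⟨rfl, rfl⟩ <;> omega
  color_eq i j h := by
    rcases h with ⟨-, -, h3⟩ | ⟨rfl, rfl⟩
    · simp [h3]
    · simp [hc]
  eqvGen i j hi hj hij := by
    have hedge : Relation.EqvGen (addEdge (sameColor c n) l) 0 l := .rel _ _ (Or.inr ⟨rfl, rfl⟩)
    have hbase := fun {i j : ℕ} => eqvGen_addEdge_sameColor c n l (i := i) (j := j)
    have hn : 0 < n := hl.trans hln
    split_ifs at hij with h1 h2 h2
    · exact hbase hi hj (h1.trans h2.symm)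
    · exact .trans _ _ _ (hbase hi hln h1)
        (.trans _ _ _ (.symm _ _ hedge) (hbase hn hj (hc.trans hij)))
    · exact .trans _ _ _ (hbase hi hn (hij.trans hc.symm))
        (.trans _ _ _ hedge (hbase hln hj h2.symm))
    · exact hbase hi hj hij

/-- The probability that an i.i.d. sample from a purely atomic measure on a sphere is constant on
the color classes of `c`. -/
lemma iid_measure_monochromatic (ν : Measure (ℕ → H × ℝ)) [IsProbabilityMeasure ν]
    (η : Measure (H × ℝ)) [IsProbabilityMeasure η] (hiid : IsIIDFrom ν η)
    (v : ℕ → ℝ) (ξ : ℕ → H) (hξ : ∀ l l', l ≠ l' → ξ l ≠ ξ l')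
    (hη : η.map Prod.fst = Measure.sum fun l => ENNReal.ofReal (v l) • Measure.dirac (ξ l))
    (q : ℝ) (hq : η.map Prod.fst {x | ‖x‖ ^ 2 = q} = 1)
    (r : ℕ → ℕ → Prop) (c : ℕ → ℕ) (n : ℕ) (hr : Generates r c n) :
    ν {x | ∀ i j, r i j → genMat x i j = q}
      = ∏ k ∈ (Finset.range n).image c, powerSum v (Nat.count (fun i => c i = k) n) := by
  have hξ_inj : Function.Injective ξ := fun l l' h => by
    by_contra hne
    exact hξ l l' hne h
  have hatom : ∀ l, η (Prod.fst ⁻¹' {ξ l}) = ENNReal.ofReal (v l) := by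
    intro l
    rw [← Measure.map_apply measurable_fst (measurableSet_singleton _), hη,
      Measure.sum_apply _ (measurableSet_singleton _), tsum_eq_single l]
    · simp
    · intro l' hl'
      simp [hξ l' l hl']
  have hrange : MeasurableSet (Set.range ξ) := (Set.countable_range ξ).measurableSet
  have hsphere : MeasurableSet {x : H | ‖x‖ ^ 2 = q} :=
    measurableSet_eq_fun (measurable_norm.pow_const 2) measurable_const
  let G : Set H := Set.range ξ ∩ {x | ‖x‖ ^ 2 = q}
  have hG : MeasurableSet G := hrange.inter hsphere
  have hηG : η (Prod.fst ⁻¹' G) = 1 := by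
    have : IsProbabilityMeasure (η.map Prod.fst) :=
      Measure.isProbabilityMeasure_map measurable_fst.aemeasurable
    rw [← Measure.map_apply measurable_fst hG, ← mem_ae_iff_prob_eq_one hG]
    refine Filter.inter_mem ?_ ((mem_ae_iff_prob_eq_one hsphere).2 hq)
    rw [mem_ae_iff, hη, Measure.sum_apply _ hrange.compl]
    simp [hrange.compl]
  have hgood : ∀ᵐ x ∂ν, ∀ i : Fin n, x (i : ℕ) ∈ Prod.fst ⁻¹' G := by
    have hG_meas : MeasurableSet {x : ℕ → H × ℝ | ∀ i : Fin n, x (i : ℕ) ∈ Prod.fst ⁻¹' G} := by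
      rw [Set.ofPred_forall]
      exact MeasurableSet.iInter fun i => (measurable_pi_apply _) (measurable_fst hG)
    refine (mem_ae_iff_prob_eq_one hG_meas).2 ?_
    rw [hiid n (fun _ => Prod.fst ⁻¹' G) fun _ => measurable_fst hG]
    simp [hηG]
  let I : Finset ℕ := (Finset.range n).image c
  have hI : ∀ i : Fin n, c i ∈ I := fun i =>
    Finset.mem_image_of_mem c (Finset.mem_range.2 i.2)
  let B : (I → ℕ) → Set (ℕ → H × ℝ) := fun a =>
    {x | ∀ i : Fin n, x (i : ℕ) ∈ Prod.fst ⁻¹' {ξ (a ⟨c i, hI i⟩)}}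
  have hB_meas : ∀ a, MeasurableSet (B a) := fun a => by
    simp only [B]
    rw [Set.ofPred_forall]
    exact MeasurableSet.iInter fun i =>
      (measurable_pi_apply _) (measurable_fst (measurableSet_singleton _))
  have hB_disj : Pairwise (Function.onFun Disjoint B) := by
    intro a b hab
    refine Set.disjoint_left.2 fun x hxa hxb => hab (funext fun k => ?_)
    obtain ⟨i, hi, hik⟩ := Finset.mem_image.1 k.2
    have hk : (⟨c i, hI ⟨i, Finset.mem_range.1 hi⟩⟩ : I) = k := Subtype.ext hik
    have ha : (x i).1 = ξ (a _) := hxa ⟨i, Finset.mem_range.1 hi⟩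
    have hb : (x i).1 = ξ (b _) := hxb ⟨i, Finset.mem_range.1 hi⟩
    rw [hk] at ha hb
    exact hξ_inj (ha.symm.trans hb)
  have hB : ∀ a, ν (B a)
      = ∏ k : I, (((v (a k)).toNNReal ^ Nat.count (fun i => c i = k) n : NNReal) : ENNReal) := by
    intro a
    let u : ℕ → ENNReal := fun k => if h : k ∈ I then ENNReal.ofReal (v (a ⟨k, h⟩)) else 0
    have hu : ∀ k : I, u k = ENNReal.ofReal (v (a k)) := fun k => by simp [u]
    simp only [B]
    rw [hiid n (fun i => Prod.fst ⁻¹' {ξ (a ⟨c i, hI i⟩)})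
      fun _ => measurable_fst (measurableSet_singleton _)]
    simp only [hatom]
    have hprod : ∏ i : Fin n, ENNReal.ofReal (v (a ⟨c i, hI i⟩)) = ∏ i ∈ Finset.range n, u (c i) := by
      rw [Finset.prod_range]
      exact Finset.prod_congr rfl fun i _ => (hu ⟨c i, hI i⟩).symm
    rw [hprod, Finset.prod_comp, ← Finset.prod_coe_sort]
    push_cast
    refine Finset.prod_congr rfl fun k _ => ?_
    rw [hu, Nat.count_eq_card_filter_range]
    rfl
  have hevent : {x : ℕ → H × ℝ | ∀ i j, r i j → genMat x i j = q} =ᵐ[ν] ⋃ a, B a := by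
    filter_upwards [hgood] with x hx
    refine propext ?_
    change (∀ i j, r i j → genMat x i j = q) ↔ x ∈ ⋃ a, B a
    have hstep : (∀ i j, r i j → genMat x i j = q) ↔ ∀ i j, r i j → (x i).1 = (x j).1 := by
      refine forall₂_congr fun i j => forall_congr' fun hij => ?_
      obtain ⟨hlt, hjn⟩ := hr.lt i j hij
      rw [genMat, if_neg hlt.ne, add_zero]
      exact inner_eq_iff_eq_of_norm_sq_eq (hx ⟨i, hlt.trans hjn⟩).2 (hx ⟨j, hjn⟩).2
    rw [hstep, hr.forall_eq_iff fun i => (x i).1, Set.mem_iUnion]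
    constructor
    · intro h
      have hsel : ∀ k : I, ∃ l, ∀ i : Fin n, c i = k → (x i).1 = ξ l := by
        intro k
        obtain ⟨i, hi, hik⟩ := Finset.mem_image.1 k.2
        obtain ⟨l, hl⟩ := (hx ⟨i, Finset.mem_range.1 hi⟩).1
        refine ⟨l, fun j hj => ?_⟩
        rw [hl]
        exact h j i j.2 (Finset.mem_range.1 hi) (hj.trans hik.symm)
      choose a ha using hsel
      exact ⟨a, fun i => ha _ i rfl⟩
    · rintro ⟨a, ha⟩ i j hi hj hij
      have h1 : (x i).1 = ξ (a _) := ha ⟨i, hi⟩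
      have h2 : (x j).1 = ξ (a _) := ha ⟨j, hj⟩
      rw [h1, h2]
      simp only [hij]
  rw [measure_congr hevent, measure_iUnion hB_disj hB_meas]
  simp only [hB]
  refine (prod_tsum_coe_nnreal fun (k : I) l =>
    (v l).toNNReal ^ Nat.count (fun i => c i = k) n).symm.trans ?_
  refine Eq.trans ?_ (Finset.prod_coe_sort I fun k =>
    powerSum v (Nat.count (fun i => c i = k) n))
  refine Finset.prod_congr rfl fun k _ => ?_
  rw [powerSum, if_neg]
  · simp [ENNReal.ofReal]
  · obtain ⟨i, hi, hik⟩ := Finset.mem_image.1 k.2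
    rw [Nat.count_eq_card_filter_range]
    exact Finset.card_ne_zero.2 ⟨i, Finset.mem_filter.2 ⟨hi, hik⟩⟩

/-- Probability that all entries along a generating relation attain the radius `q`. -/
lemma measure_forall_entry_eq {Ω₁ Ω : Type*} [MeasurableSpace Ω₁] [MeasurableSpace Ω]
    (P : Measure Ω₁) (Pr : Measure Ω) (R : Ω₁ → Mat) (hR : Measurable R)
    (η : Kernel Ω (H × ℝ)) [IsMarkovKernel η]
    (ν : Kernel Ω (ℕ → H × ℝ)) [IsMarkovKernel ν]
    (hiid : ∀ ω, IsIIDFrom (ν ω) (η ω))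
    (hrep : ∀ A : Set Mat, MeasurableSet A →
      Measure.map R P A = ∫⁻ ω, Measure.map genMat (ν ω) A ∂Pr)
    (q : ℝ) (w : Ω → ℕ → ℝ)
    (hw : ∀ᵐ ω ∂Pr, (∃ ξ : ℕ → H, (∀ l l', l ≠ l' → ξ l ≠ ξ l') ∧
        (η ω).map Prod.fst
          = Measure.sum (fun l => ENNReal.ofReal (w ω l) • Measure.dirac (ξ l))) ∧
      (η ω).map Prod.fst {x | ‖x‖ ^ 2 = q} = 1)
    (r : ℕ → ℕ → Prop) (c : ℕ → ℕ) (n m : ℕ) (hr : Generates r c n) (hc : ∀ i < n, c i < m) :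
    P {ω | ∀ i j, r i j → R ω i j = q}
      = ∫⁻ ω, ∏ k ∈ Finset.range m, powerSum (w ω) (Nat.count (fun i => c i = k) n) ∂Pr := by
  have hA := measurableSet_forall_entry_eq r q
  have hrepA := hrep _ hA
  rw [Measure.map_apply hR hA] at hrepA
  refine Eq.trans hrepA (lintegral_congr_ae ?_)
  filter_upwards [hw] with ω ⟨⟨ξ, hξ, hη⟩, hq⟩
  rw [Measure.map_apply measurable_genMat hA]
  refine (iid_measure_monochromatic (ν ω) (η ω) (hiid ω) (w ω) ξ hξ hη q hq r c n hr).trans ?_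
  refine Finset.prod_subset ?_ ?_
  · intro k hk
    obtain ⟨i, hi, rfl⟩ := Finset.mem_image.1 hk
    exact Finset.mem_range.2 (hc i (Finset.mem_range.1 hi))
  · intro k _ hk
    have hzero : Nat.count (fun i => c i = k) n = 0 := by
      rw [Nat.count_eq_card_filter_range, Finset.card_eq_zero, Finset.filter_eq_empty_iff]
      exact fun i hi hik => hk (Finset.mem_image.2 ⟨i, hi, hik⟩)
    rw [hzero, powerSum_zero]

/-- The Ghirlanda–Guerra identities for events prescribing the value `q` on the pairs of equally
colored indices; for a single index they hold trivially. -/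
lemma SatisfiesGGI.measureReal_addEdge {Ω₁ : Type*} [MeasurableSpace Ω₁]
    {P : Measure Ω₁} [IsProbabilityMeasure P] {R : Ω₁ → Mat} (hR : Measurable R)
    (hGGI : SatisfiesGGI P R) (q : ℝ) (c : ℕ → ℕ) (n : ℕ) (hn : 1 ≤ n) :
    P.real {ω | ∀ i j, addEdge (sameColor c n) n i j → R ω i j = q}
      = (1 / n) * P.real {ω | ∀ i j, sameColor c n i j → R ω i j = q} * P.real {ω | R ω 0 1 = q}
        + (1 / n) * ∑ l ∈ Finset.Ico 1 n,
            P.real {ω | ∀ i j, addEdge (sameColor c n) l i j → R ω i j = q} := by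
  classical
  have hmeas : ∀ r : ℕ → ℕ → Prop, MeasurableSet {ω | ∀ i j, r i j → R ω i j = q} := fun r =>
    hR (measurableSet_forall_entry_eq r q)
  rcases hn.eq_or_lt with rfl | hn2
  · have hempty : ∀ i j, ¬ sameColor c 1 i j := fun i j h => by
      have h1 := h.1
      have h2 := h.2.1
      omega
    simp [addEdge, hempty]
  let f : ({p : Fin n × Fin n // p.1 < p.2} → ℝ) → ℝ :=
    Set.indicator {x | ∀ p, c p.1.1 = c p.1.2 → x p = q} 1
  let ψ : ℝ → ℝ := Set.indicator {q} 1
  have hf : Measurable f := by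
    refine measurable_one.indicator ?_
    simp only [Set.ofPred_forall]
    exact MeasurableSet.iInter fun p => MeasurableSet.iInter fun _ =>
      measurableSet_eq_fun (measurable_pi_apply p) measurable_const
  have hψ : Measurable ψ := measurable_one.indicator (measurableSet_singleton q)
  have hind : ∀ {α : Type} (s : Set α) (x : α), |s.indicator (1 : α → ℝ) x| ≤ 1 := by
    intro α s x
    by_cases hx : x ∈ s <;> simp [hx]
  have hsub : ∀ M : Mat, subU n M ∈ {x : {p : Fin n × Fin n // p.1 < p.2} → ℝ |
      ∀ p, c p.1.1 = c p.1.2 → x p = q} ↔ ∀ i j, sameColor c n i j → M i j = q := by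
    intro M
    constructor
    · rintro h i j ⟨hij, hj, hc⟩
      exact h ⟨(⟨i, hij.trans hj⟩, ⟨j, hj⟩), hij⟩ hc
    · rintro h ⟨⟨i, j⟩, hij⟩ hc
      exact h i j ⟨hij, j.2, hc⟩
  have hfψ : ∀ l, ∫ ω, f (subU n (R ω)) * ψ (R ω 0 l) ∂P
      = P.real {ω | ∀ i j, addEdge (sameColor c n) l i j → R ω i j = q} := by
    intro l
    rw [← integral_indicator_one (hmeas _)]
    refine integral_congr_ae (Filter.Eventually.of_forall fun ω => ?_)
    have hiff : (∀ i j, addEdge (sameColor c n) l i j → R ω i j = q)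
        ↔ (∀ i j, sameColor c n i j → R ω i j = q) ∧ R ω 0 l = q := by
      constructor
      · exact fun h => ⟨fun i j hij => h i j (Or.inl hij), h 0 l (Or.inr ⟨rfl, rfl⟩)⟩
      · rintro ⟨h1, h2⟩ i j (hij | ⟨rfl, rfl⟩)
        exacts [h1 i j hij, h2]
    simp only [f, ψ, Set.indicator_apply, hsub, Set.mem_singleton_iff, Set.mem_ofPred_eq, hiff]
    by_cases h1 : ∀ i j, sameColor c n i j → R ω i j = q <;> by_cases h2 : R ω 0 l = q <;>
      simp [h1, h2]
  have hf_int : ∫ ω, f (subU n (R ω)) ∂P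
      = P.real {ω | ∀ i j, sameColor c n i j → R ω i j = q} := by
    rw [← integral_indicator_one (hmeas _)]
    refine integral_congr_ae (Filter.Eventually.of_forall fun ω => ?_)
    simp only [f, Set.indicator_apply, hsub, Set.mem_ofPred_eq, Pi.one_apply]
  have hψ_int : ∫ ω, ψ (R ω 0 1) ∂P = P.real {ω | R ω 0 1 = q} := by
    have hR01 : Measurable fun ω => R ω 0 1 :=
      (measurable_pi_apply 1).comp ((measurable_pi_apply 0).comp hR)
    exact integral_indicator_one (hR01 (measurableSet_singleton q))
  have h := hGGI n hn2 f hf ⟨1, hind _⟩ ψ hψ ⟨1, hind _⟩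
  simpa only [hfψ, hf_int, hψ_int] using h

/-- The Ghirlanda–Guerra identities imply the Poisson–Dirichlet recursion for the
moments `S(n₁,…,n_m) = E ∏_j Σ_l w_l^{n_j}` of the weights of the directing
measure: with `s = 1 - F({q*})` and `n = n₁ + ⋯ + n_m`,
`S(n₁+1,n₂,…,n_m) = ((n₁-s)/n) S(n₁,…,n_m) + Σ_{p≥2} (n_p/n) S(n₁+n_p,…)`. -/
theorem weights_moment_recursion
    {Ω₁ Ω : Type*} [MeasurableSpace Ω₁] [MeasurableSpace Ω]
    (P : Measure Ω₁) [IsProbabilityMeasure P] (Pr : Measure Ω) [IsProbabilityMeasure Pr]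
    (R : Ω₁ → Mat) (hGdF : IsGramDeFinetti P R) (hGGI : SatisfiesGGI P R)
    (η : Kernel Ω (H × ℝ)) [IsMarkovKernel η]
    (hpos : ∀ ω, η ω {p | p.2 < 0} = 0)
    (ν : Kernel Ω (ℕ → H × ℝ)) [IsMarkovKernel ν]
    (hiid : ∀ ω, IsIIDFrom (ν ω) (η ω))
    (hrep : ∀ A : Set Mat, MeasurableSet A →
      Measure.map R P A = ∫⁻ ω, Measure.map genMat (ν ω) A ∂Pr)
    (μ : Ω → Measure H) (hμ : ∀ ω, μ ω = (η ω).map Prod.fst)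
    (F : Measure ℝ) (hF : F = Measure.map (fun ω₁ => R ω₁ 0 1) P)
    (qs : ℝ) (hqs_top : F (Set.Ioi qs) = 0)
    (hqs_supp : ∀ ε : ℝ, 0 < ε → 0 < F (Set.Ioo (qs - ε) (qs + ε)))
    (hatom : 0 < F {qs}) (hatom1 : F {qs} < 1)
    (s : ℝ) (hs : s = 1 - (F {qs}).toReal)
    (w : Ω → ℕ → ℝ) (hw_meas : Measurable w)
    (hw : ∀ᵐ ω ∂Pr, (∀ l, 0 ≤ w ω l) ∧ (∀ l, w ω (l + 1) ≤ w ω l) ∧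
      (∃ ξ : ℕ → H, (∀ l l', l ≠ l' → ξ l ≠ ξ l') ∧
        μ ω = Measure.sum (fun l => ENNReal.ofReal (w ω l) • Measure.dirac (ξ l))) ∧
      μ ω {x | ‖x‖ ^ 2 = qs} = 1)
    (S : List ℕ → ℝ)
    (hS : ∀ L : List ℕ, S L = ∫ ω, (L.map (fun nj => ∑' l, (w ω l) ^ nj)).prod ∂Pr)
    (n₁ : ℕ) (hn₁ : 1 ≤ n₁) (ns : List ℕ) (hns : ∀ x ∈ ns, 1 ≤ x)
    (n : ℕ) (hn : n = n₁ + ns.sum) :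
    S ((n₁ + 1) :: ns)
      = (((n₁ : ℝ) - s) / n) * S (n₁ :: ns)
        + ∑ p : Fin ns.length,
            ((ns.get p : ℝ) / n) * S ((n₁ + ns.get p) :: ns.eraseIdx p) := by
  have hR : Measurable R := hGdF.1
  have hw' : ∀ᵐ ω ∂Pr, (∃ ξ : ℕ → H, (∀ l l', l ≠ l' → ξ l ≠ ξ l') ∧
        (η ω).map Prod.fst
          = Measure.sum (fun l => ENNReal.ofReal (w ω l) • Measure.dirac (ξ l))) ∧
      (η ω).map Prod.fst {x | ‖x‖ ^ 2 = qs} = 1 := by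
    filter_upwards [hw] with ω hω
    rw [← hμ]
    exact hω.2.2
  have hw1 : ∀ᵐ ω ∂Pr, (∀ l, 0 ≤ w ω l) ∧ ∑' l, ENNReal.ofReal (w ω l) = 1 := by
    filter_upwards [hw, hw'] with ω hω ⟨⟨ξ, _, hη⟩, _⟩
    refine ⟨hω.1, ?_⟩
    have hmass : (η ω).map Prod.fst Set.univ = 1 := by
      rw [Measure.map_apply measurable_fst MeasurableSet.univ, Set.preimage_univ, measure_univ]
    rw [← hmass, hη, Measure.sum_apply _ MeasurableSet.univ]
    simp
  have hn0 : 1 ≤ n := by omega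
  let L := n₁ :: ns
  have hLn : L.sum = n := by simp [L, hn]
  have hL : ∀ k ∈ L, 1 ≤ k := List.forall_mem_cons.2 ⟨hn₁, hns⟩
  let c := blockIndex L
  have hc0 : c 0 = 0 := by
    simp only [c, L, blockIndex]
    rw [if_pos (by omega)]
  have hclt : ∀ i < n, c i < ns.length + 1 := fun i hi => blockIndex_lt L i (hLn ▸ hi)
  have hcount : ∀ k < ns.length + 1, Nat.count (fun i => c i = k) n = L.getD k 0 := fun k hk =>
    hLn ▸ count_blockIndex L k hk
  -- moments are probabilities of monochromatic configurations
  have key : ∀ (r : ℕ → ℕ → Prop) (c' : ℕ → ℕ) (n' : ℕ) (L' : List ℕ), Generates r c' n' →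
      (∀ i < n', c' i < ns.length + 1) → (∀ k ∈ L', 1 ≤ k) →
      (∀ g : ℕ → ENNReal, g 0 = 1 →
        ∏ k ∈ Finset.range (ns.length + 1), g (Nat.count (fun i => c' i = k) n')
          = (L'.map g).prod) →
      P.real {ω | ∀ i j, r i j → R ω i j = qs} = S L' := by
    intro r c' n' L' hr hlt hL' hprod
    rw [hS, integral_prod_tsum_pow Pr w hw_meas hw1 L' hL', measureReal_def,
      measure_forall_entry_eq P Pr R hR η ν hiid hrep qs w hw' r c' n' _ hr hlt]
    simp only [hprod _ (powerSum_zero _)]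
  have hbase : P.real {ω | ∀ i j, sameColor c n i j → R ω i j = qs} = S L := by
    refine key _ c n L (generates_sameColor c n) hclt hL fun g _ => ?_
    rw [← prod_range_getD]
    exact Finset.prod_congr rfl fun k hk => by rw [hcount k (Finset.mem_range.1 hk)]
  have hext : P.real {ω | ∀ i j, addEdge (sameColor c n) n i j → R ω i j = qs}
      = S ((n₁ + 1) :: ns) := by
    refine key _ _ (n + 1) _ (generates_extend c n hn0 hc0) ?_
      (List.forall_mem_cons.2 ⟨by omega, hns⟩) fun g _ => ?_
    · intro i hi
      split_ifs with h
      · omega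
      · exact hclt i (by omega)
    · rw [← prod_range_getD]
      refine Finset.prod_congr rfl fun k hk => ?_
      rw [count_extend, hcount k (Finset.mem_range.1 hk)]
      cases k <;> simp [L]
  let U : ℕ → ℝ := fun k =>
    if k = 0 then S L else S ((n₁ + ns.getD (k - 1) 0) :: ns.eraseIdx (k - 1))
  have hmerge : ∀ l ∈ Finset.Ico 1 n,
      P.real {ω | ∀ i j, addEdge (sameColor c n) l i j → R ω i j = qs} = U (c l) := by
    intro l hl
    obtain ⟨hl1, hln⟩ := Finset.mem_Ico.1 hl
    have hgen := generates_merge c n l hc0 hl1 hln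
    have hlt : ∀ i < n, (if c i = c l then 0 else c i) < ns.length + 1 := by
      intro i hi
      have := hclt i hi
      split_ifs <;> omega
    obtain h0 | ⟨p, hp⟩ : c l = 0 ∨ ∃ p, c l = p + 1 := by
      cases c l <;> simp
    · simp only [U, h0, if_pos]
      refine key _ _ n L hgen hlt hL fun g _ => ?_
      rw [← prod_range_getD]
      refine Finset.prod_congr rfl fun k hk => ?_
      rw [← hcount k (Finset.mem_range.1 hk), h0]
      congr! 4 with i
      split_ifs with h <;> simp [h]
    · have hpn : p < ns.length := by
        have := hclt l hln
        omega
      simp only [U, hp, if_neg (Nat.succ_ne_zero p), Nat.add_sub_cancel]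
      refine key _ _ n _ hgen hlt (List.forall_mem_cons.2
        ⟨by omega, fun k hk => hns k (List.mem_of_mem_eraseIdx hk)⟩) fun g hg => ?_
      rw [List.map_cons, List.prod_cons, ← prod_range_getD_eraseIdx ns g hg p hpn,
        Finset.prod_range_succ', mul_comm]
      simp only [count_merge c (c l) (by omega)]
      congr 1
      · rw [if_pos trivial, hp, hcount 0 (by omega), hcount (p + 1) (by omega)]
        simp [L]
      · refine Finset.prod_congr rfl fun k hk => ?_
        rw [hp, hcount (k + 1) (by have := Finset.mem_range.1 hk; omega)]
        simp [L]
  have hs' : P.real {ω | R ω 0 1 = qs} = 1 - s := by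
    have hR01 : Measurable fun ω => R ω 0 1 :=
      (measurable_pi_apply 1).comp ((measurable_pi_apply 0).comp hR)
    rw [hs, hF, Measure.map_apply hR01 (measurableSet_singleton qs), measureReal_def]
    simp only [sub_sub_cancel]
    rfl
  have hsum : ∑ l ∈ Finset.Ico 1 n, U (c l)
      = (n₁ - 1) * S L + ∑ p : Fin ns.length,
          (ns.get p : ℝ) * S ((n₁ + ns.get p) :: ns.eraseIdx p) := by
    have htotal := sum_blockIndex L U
    rw [hLn, Finset.range_eq_Ico, Finset.sum_eq_sum_Ico_succ_bot hn0] at htotal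
    have hU0 : U (blockIndex L 0) = S L := by
      change U (c 0) = S L
      rw [hc0]
      rfl
    have hUL : ∑ k ∈ Finset.range L.length, (L.getD k 0 : ℝ) * U k
        = ∑ p : Fin ns.length, (ns.get p : ℝ) * S ((n₁ + ns.get p) :: ns.eraseIdx p)
          + n₁ * S L := by
      rw [List.length_cons, Finset.sum_range_succ', Finset.sum_range]
      simp [L, U]
    rw [hUL, hU0] at htotal
    change ∑ l ∈ Finset.Ico (0 + 1) n, U (blockIndex L l) = _
    linarith
  have hfinal := hGGI.measureReal_addEdge hR qs c n hn0
  rw [hext, hbase, hs', Finset.sum_congr rfl hmerge, hsum] at hfinal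
  have hsplit : ∑ p : Fin ns.length,
        ((ns.get p : ℝ) / n) * S ((n₁ + ns.get p) :: ns.eraseIdx p)
      = (1 / n) * ∑ p : Fin ns.length,
          (ns.get p : ℝ) * S ((n₁ + ns.get p) :: ns.eraseIdx p) := by
    rw [Finset.mul_sum]
    exact Finset.sum_congr rfl fun p _ => by ring
  rw [hfinal, hsplit]
  ring

end
end
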